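/- Let Ω ⊆ ℝ² be a nonempty bounded convex open set. There exists a constant C > 0, depending only on Ω, with the following property: let τ : Ω → ℝ² be a smooth vector field with div τ = 0 on Ω, and let M ≥ 0 be a real number such that ∫_Ω τ · φ dx ≤ M for every smooth compactly supported vector field φ : ℝ² → ℝ² whose support is contained in Ω and which satisfies ∫_Ω ‖Dφ(x)‖_F² dx ≤ 1 (Dφ the Jacobian matrix). Then there exists a smooth scalar field ω : Ω → ℝ with curl ω = τ on Ω (i.e. ∂₂ω = τ₁ and −∂₁ω = τ₂ on Ω) and ∫_Ω ω(x)² dx ≤ C·M². (Smooth-data version of the quantitative scalar curl-potential estimate used in the appendix, quoted from Costabel–McIntosh with s = −1.) -/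

import Mathlib

open MeasureTheory

noncomputable section

abbrev E2 : Type := EuclideanSpace ℝ (Fin 2)

/-- Partial derivative in direction `i`. -/
def pd (i : Fin 2) (f : E2 → ℝ) (x : E2) : ℝ :=
  fderiv ℝ f x (EuclideanSpace.single i 1)

/-- Row-wise curl of a vector field: the `i`-th row is `(∂₂θᵢ, −∂₁θᵢ)`. -/
def curlVec (θ : E2 → Fin 2 → ℝ) (x : E2) : Matrix (Fin 2) (Fin 2) ℝ :=
  Matrix.of fun i j => if j = 0 then pd 1 (fun y => θ y i) x else -(pd 0 (fun y => θ y i) x)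

/-- Symmetric part of the row-wise curl. -/
def symCurl (θ : E2 → Fin 2 → ℝ) (x : E2) : Matrix (Fin 2) (Fin 2) ℝ :=
  (2⁻¹ : ℝ) • (curlVec θ x + (curlVec θ x).transpose)

/-- Row-wise divergence of a matrix field. -/
def divMat (B : E2 → Matrix (Fin 2) (Fin 2) ℝ) (x : E2) : Fin 2 → ℝ :=
  fun i => pd 0 (fun y => B y i 0) x + pd 1 (fun y => B y i 1) x

/-- Double divergence of a matrix field. -/
def divDiv (B : E2 → Matrix (Fin 2) (Fin 2) ℝ) (x : E2) : ℝ :=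
  pd 0 (fun y => divMat B y 0) x + pd 1 (fun y => divMat B y 1) x

/-- Hessian of a scalar field. -/
def hess (v : E2 → ℝ) (x : E2) : Matrix (Fin 2) (Fin 2) ℝ :=
  Matrix.of fun i j => pd i (fun y => pd j v y) x

/-- Jacobian matrix of a vector field. -/
def jac (θ : E2 → Fin 2 → ℝ) (x : E2) : Matrix (Fin 2) (Fin 2) ℝ :=
  Matrix.of fun i j => pd j (fun y => θ y i) x

/-- Frobenius inner product of 2×2 matrices. -/
def frob (A B : Matrix (Fin 2) (Fin 2) ℝ) : ℝ := ∑ i, ∑ j, A i j * B i j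


open Set Metric in
lemma fried_gauge_lip {D : Set ℂ} (hc : Convex ℝ D) {ρ : ℝ} (hρ : 0 < ρ) (h1 : ball 0 ρ ⊆ D) :
    LipschitzWith (Real.toNNReal (1/ρ)) (fun θ : ℝ => gauge D (circleMap 0 1 θ)) := by
  have hg : LipschitzWith (Real.toNNReal (1/ρ)) (gauge D) := by
    have h := hc.lipschitzWith_gauge (r := ρ.toNNReal) (by simpa using hρ)
      (by simpa [Real.coe_toNNReal _ hρ.le] using h1)
    simpa [one_div, Real.toNNReal_inv] using h
  have := hg.comp (lipschitzWith_circleMap 0 1)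
  simpa [Function.comp_def] using this

open Set Metric in
lemma fried_gauge_bounds {D : Set ℂ} {ρ R : ℝ} (hρ : 0 < ρ) (hR : 0 < R)
    (h1 : ball 0 ρ ⊆ D) (h2 : D ⊆ closedBall 0 R) (θ : ℝ) :
    1 / R ≤ gauge D (circleMap 0 1 θ) ∧ gauge D (circleMap 0 1 θ) ≤ 1 / ρ := by
  have habs : Absorbent ℝ D :=
    absorbent_nhds_zero (Filter.mem_of_superset (ball_mem_nhds _ hρ) h1)
  constructor
  · have := le_gauge_of_subset_closedBall (x := circleMap 0 1 θ) habs hR.le h2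
    simpa using this
  · have := mul_gauge_le_norm (x := circleMap 0 1 θ) h1
    rw [le_div_iff₀ hρ, mul_comm]
    simpa using this

open Set Metric in
lemma fried_boundary {D : Set ℂ} (hc : Convex ℝ D) (ho : IsOpen D) {ρ R : ℝ} (hρ : 0 < ρ)
    (hR : 0 < R) (h1 : ball 0 ρ ⊆ D) (h2 : D ⊆ closedBall 0 R) (F : ℂ → ℂ)
    (hF : DifferentiableOn ℂ F D) (h0 : (F 0).re = 0) {s : ℝ} (hs0 : 0 ≤ s) (hs : s < 1)
    (z : ℝ → ℂ) (hz : ∀ θ, z θ = (s / gauge D (circleMap 0 1 θ)) • circleMap 0 1 θ) :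
    Continuous z ∧ (∀ θ, z θ ∈ D) ∧
    ∫ θ in (-Real.pi)..Real.pi, (F (z θ)).re ^ 2 ≤
      (2 + 4 * (R / ρ) ^ 2) * ∫ θ in (-Real.pi)..Real.pi, (F (z θ)).im ^ 2 := by
  set p : ℝ → ℝ := fun θ => gauge D (circleMap 0 1 θ) with hp
  have hz' : ∀ θ, z θ = (s / p θ) • circleMap 0 1 θ := hz
  have hplip : LipschitzWith (Real.toNNReal (1/ρ)) p := fried_gauge_lip hc hρ h1
  have hpR : ∀ θ, 1 / R ≤ p θ := fun θ => (fried_gauge_bounds hρ hR h1 h2 θ).1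
  have hp0 : ∀ θ, 0 < p θ := fun θ => lt_of_lt_of_le (by positivity) (hpR θ)
  have h0D : (0 : ℂ) ∈ D := h1 (mem_ball_self hρ)
  have hzD : ∀ θ, gauge D (z θ) = s := by
    intro θ
    rw [hz', gauge_smul_of_nonneg (div_nonneg hs0 (hp0 θ).le)]
    simp only [smul_eq_mul]
    exact div_mul_cancel₀ _ (hp0 θ).ne'
  have hzmem : ∀ θ, z θ ∈ D := by
    intro θ
    have := setOfPred_gauge_lt_one_eq_self_of_isOpen hc h0D ho
    rw [← this]
    simpa [hzD θ] using hs
  -- Lipschitz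
  have hnorm : ∀ θ, ‖circleMap 0 1 θ‖ = 1 := by intro θ; simp
  have hzlip : LipschitzWith (Real.toNNReal (s * R^2/ρ + s * R)) z := by
    refine LipschitzWith.of_dist_le_mul fun a b => ?_
    rw [Real.coe_toNNReal _ (by positivity), dist_eq_norm, hz', hz']
    have e1 : (s / p a) • circleMap 0 1 a - (s / p b) • circleMap 0 1 b =
      (s / p a - s / p b) • circleMap 0 1 a + (s / p b) • (circleMap 0 1 a - circleMap 0 1 b) := by
      module
    rw [e1]
    refine (norm_add_le _ _).trans ?_
    rw [norm_smul, norm_smul, hnorm, mul_one, add_mul]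
    have e2 : |p a - p b| ≤ (1/ρ) * dist a b := by
      have := hplip.dist_le_mul a b
      rwa [Real.coe_toNNReal _ (by positivity), Real.dist_eq] at this
    have e3 : ‖circleMap 0 1 a - circleMap 0 1 b‖ ≤ dist a b := by
      have := (lipschitzWith_circleMap 0 1).dist_le_mul a b
      simpa [dist_eq_norm] using this
    have i1 : 1 / p a ≤ R := by
      rw [div_le_iff₀ (hp0 a)]; have := hpR a; rw [div_le_iff₀ hR] at this; linarith
    have i2 : 1 / p b ≤ R := by
      rw [div_le_iff₀ (hp0 b)]; have := hpR b; rw [div_le_iff₀ hR] at this; linarith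
    have hb : s / p b ≤ s * R := by
      rw [div_eq_mul_one_div]; gcongr
    gcongr
    · have : s / p a - s / p b = s * (1 / p a) * (1 / p b) * (p b - p a) := by
        have := (hp0 a).ne'; have := (hp0 b).ne'
        field_simp
      rw [this, Real.norm_eq_abs, abs_mul, abs_of_nonneg (by have := hp0 a; have := hp0 b; positivity), abs_sub_comm]
      have := hp0 a; have := hp0 b
      calc s * (1 / p a) * (1 / p b) * |p a - p b| ≤ s * R * R * ((1/ρ) * dist a b) := by gcongr
        _ = _ := by ring
    · rw [Real.norm_eq_abs, abs_of_nonneg (by have := hp0 b; positivity)]; exact hb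
  refine ⟨hzlip.continuous, hzmem, ?_⟩
  -- primitive
  set H : ℂ → ℂ := fun w => F w ^ 2 with hH
  have hHd : DifferentiableOn ℂ H D := hF.pow 2
  have hK : DifferentiableOn ℂ (dslope H 0) D :=
    (Complex.differentiableOn_dslope (ho.mem_nhds h0D)).2 hHd
  obtain ⟨Q, hQ⟩ := hc.exists_forall_hasDerivWithinAt hK
  have hQ' : ∀ w ∈ D, HasDerivAt Q (dslope H 0 w) w := fun w hw =>
    (hQ w hw).hasDerivAt (ho.mem_nhds hw)
  -- AC of G
  set G : ℝ → ℝ := fun θ => (Q (z θ)).im with hG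
  have hGac : AbsolutelyContinuousOnInterval G (-Real.pi) Real.pi := by
    -- the compact convex set containing the curve
    have habs : Absorbent ℝ D :=
      absorbent_nhds_zero (Filter.mem_of_superset (ball_mem_nhds _ hρ) h1)
    set S : Set ℂ := {w | gauge D w ≤ s} with hSdef
    have hSc : Convex ℝ S := hc.setOfPred_gauge_le h0D habs s
    have hSD : S ⊆ D := by
      intro w hw
      have := setOfPred_gauge_lt_one_eq_self_of_isOpen hc h0D ho
      rw [← this]
      exact lt_of_le_of_lt hw hs
    have hS : IsCompact S := by
      refine Metric.isCompact_of_isClosed_isBounded ?_ ?_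
      · exact isClosed_le (continuous_gauge hc (ho.mem_nhds h0D)) continuous_const
      · exact (isBounded_closedBall.subset h2).subset hSD
    obtain ⟨B, hB⟩ := hS.exists_bound_of_continuousOn (hK.continuousOn.mono hSD)
    have hQl : LipschitzOnWith B.toNNReal Q S := by
      refine hSc.lipschitzOnWith_of_nnnorm_hasDerivWithin_le
        (f' := dslope H 0) (fun w hw => (hQ' w (hSD hw)).hasDerivWithinAt) fun w hw => ?_
      rw [← NNReal.coe_le_coe, coe_nnnorm]
      exact (hB w hw).trans (Real.le_coe_toNNReal B)
    have hpi : -Real.pi ≤ Real.pi := by linarith [Real.pi_pos]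
    have hcomp : LipschitzOnWith (1 * (B.toNNReal * Real.toNNReal (s * R^2/ρ + s * R))) G
        (uIcc (-Real.pi) Real.pi) := by
      rw [uIcc_of_le hpi]
      have him : LipschitzWith 1 Complex.im := by
        refine LipschitzWith.of_dist_le_mul fun a b => ?_
        simpa [Real.dist_eq, dist_eq_norm] using Complex.abs_im_le_norm (a - b)
      exact him.comp_lipschitzOnWith (hQl.comp hzlip.lipschitzOnWith
        (fun θ hθ => (hzD θ).le))
    exact hcomp.absolutelyContinuousOnInterval
  have hGend : G Real.pi - G (-Real.pi) = 0 := by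
    have e : circleMap 0 1 Real.pi = circleMap 0 1 (-Real.pi) := by
      simp [circleMap, Complex.exp_neg]
    have : z Real.pi = z (-Real.pi) := by rw [hz, hz, e]
    simp [hG, this]
  have hFTC := hGac.integral_deriv_eq_sub
  rw [hGend] at hFTC
  have hfc : Continuous fun θ => F (z θ) :=
    hF.continuousOn.comp_continuous hzlip.continuous hzmem
  have hle : ∀ᵐ θ : ℝ, (1/2) * (F (z θ)).re ^ 2 - (1 + 2 * (R/ρ)^2) * (F (z θ)).im ^ 2 ≤ deriv G θ := by
    filter_upwards [hplip.ae_differentiableAt_real] with θ hθ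
    set a := deriv p θ / p θ with ha
    have hpd : HasDerivAt p (deriv p θ) θ := hθ.hasDerivAt
    have ha' : |a| ≤ R / ρ := by
      have e1 : |deriv p θ| ≤ 1 / ρ := by
        have := norm_deriv_le_of_lipschitz (x₀ := θ) hplip
        rwa [Real.coe_toNNReal _ (by positivity), Real.norm_eq_abs] at this
      rw [ha, abs_div, abs_of_pos (hp0 θ), div_le_iff₀ (hp0 θ)]
      have := hpR θ
      calc |deriv p θ| ≤ 1 / ρ := e1
        _ = R / ρ * (1 / R) := by field_simp
        _ ≤ _ := by gcongr
    have hzd : HasDerivAt z (z θ * (Complex.I - a)) θ := by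
      have d1 : HasDerivAt (fun θ => s / p θ) (-(s / p θ) * a) θ := by
        have := (hasDerivAt_const θ s).div hpd (hp0 θ).ne'
        convert! this using 1
        have := (hp0 θ).ne'
        rw [ha]; field_simp; ring
      have d2 := d1.smul (hasDerivAt_circleMap 0 1 θ)
      have : z = fun θ => (s / p θ) • circleMap 0 1 θ := funext hz'
      rw [this]
      convert! d2 using 1
      simp only [Complex.real_smul]
      push_cast
      ring
    have hGd : HasDerivAt G ((dslope H 0 (z θ) * (z θ * (Complex.I - a))).im) θ := by
      have h4 := (hQ' _ (hzmem θ)).scomp θ hzd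
      have h5 := Complex.imCLM.hasFDerivAt.comp_hasDerivAt θ h4
      convert! h5 using 1
      simp [mul_comm]
    rw [hGd.deriv]
    have hsl : dslope H 0 (z θ) * z θ = H (z θ) - H 0 := by
      have := sub_smul_dslope H 0 (z θ)
      rw [sub_zero, smul_eq_mul] at this
      rw [mul_comm, this]
    rw [← mul_assoc, hsl]
    set f := (F (z θ)).re
    set g := (F (z θ)).im
    have : ((H (z θ) - H 0) * (Complex.I - a)).im = f^2 - g^2 + (F 0).im^2 - 2 * a * f * g := by
      simp [hH, pow_two, h0]; ring
    rw [this]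
    have h3 : 2 * a * f * g ≤ (1/2) * f^2 + 2 * (R/ρ)^2 * g^2 := by
      have : a^2 ≤ (R/ρ)^2 := sq_le_sq' (by linarith [(abs_le.1 ha').1]) (abs_le.1 ha').2
      nlinarith [sq_nonneg (f - 2 * a * g), mul_le_mul_of_nonneg_right this (sq_nonneg g)]
    nlinarith [sq_nonneg (F 0).im]
  have hpi : -Real.pi ≤ Real.pi := by linarith [Real.pi_pos]
  have hi1 : IntervalIntegrable (fun θ => (F (z θ)).re ^ 2) volume (-Real.pi) Real.pi :=
    Continuous.intervalIntegrable ((Complex.continuous_re.comp hfc).pow 2) _ _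
  have hi2 : IntervalIntegrable (fun θ => (F (z θ)).im ^ 2) volume (-Real.pi) Real.pi :=
    Continuous.intervalIntegrable ((Complex.continuous_im.comp hfc).pow 2) _ _
  have := intervalIntegral.integral_mono_ae hpi ((hi1.const_mul (1/2)).sub (hi2.const_mul (1 + 2 * (R/ρ)^2)))
    hGac.intervalIntegrable_deriv hle
  rw [hFTC, intervalIntegral.integral_sub (hi1.const_mul (1/2)) (hi2.const_mul (1 + 2 * (R/ρ)^2)),
    intervalIntegral.integral_const_mul, intervalIntegral.integral_const_mul] at this
  linarith

open Set Metric ENNReal in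
lemma measurable_indicator_of_continuousOn {X Y : Type*} [TopologicalSpace X] [MeasurableSpace X]
    [OpensMeasurableSpace X] [TopologicalSpace Y] [MeasurableSpace Y] [BorelSpace Y] [Zero Y]
    {D : Set X} (ho : IsOpen D) {g : X → Y} (hg : ContinuousOn g D) :
    Measurable (D.indicator g) := by
  classical
  rw [← piecewise_eq_indicator]
  exact hg.measurable_piecewise continuousOn_const ho.measurableSet

open Set Metric ENNReal in
lemma area_polar {D : Set ℂ} (hc : Convex ℝ D) (ho : IsOpen D) {ρ R : ℝ} (hρ : 0 < ρ)
    (hR : 0 < R) (h1 : ball 0 ρ ⊆ D) (h2 : D ⊆ closedBall 0 R) (u : ℂ → ℝ≥0∞)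
    (hu : Measurable u) :
    ∫⁻ w in D, u w = ∫⁻ θ in Ioo (-Real.pi) Real.pi, ∫⁻ s in Ioo (0:ℝ) 1,
      ENNReal.ofReal (s / gauge D (circleMap 0 1 θ) ^ 2) *
        u ((s / gauge D (circleMap 0 1 θ)) • circleMap 0 1 θ) := by
  have h0D : (0 : ℂ) ∈ D := h1 (mem_ball_self hρ)
  have hDm : MeasurableSet D := ho.measurableSet
  rw [← lintegral_indicator hDm, ← Complex.lintegral_comp_polarCoord_symm, polarCoord_target,
    Measure.volume_eq_prod, ← Measure.prod_restrict, lintegral_prod_symm]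
  · refine lintegral_congr fun θ => ?_
    obtain ⟨hp1, -⟩ := fried_gauge_bounds hρ hR h1 h2 θ
    set p := gauge D (circleMap 0 1 θ) with hp
    have hp0 : 0 < p := lt_of_lt_of_le (by positivity) hp1
    have himg : (fun s : ℝ => s / p) '' Ioo 0 1 = Ioo 0 (1/p) := by
      ext x
      constructor
      · rintro ⟨s, hs, rfl⟩
        exact ⟨div_pos hs.1 hp0, by simpa using div_lt_div_of_pos_right hs.2 hp0⟩
      · rintro ⟨hx0, hx1⟩
        exact ⟨x * p, ⟨by positivity, by rwa [lt_div_iff₀ hp0] at hx1⟩, by field_simp⟩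
    have hch := lintegral_image_eq_lintegral_abs_deriv_mul (s := Ioo (0:ℝ) 1) measurableSet_Ioo
      (f := fun s => s / p) (f' := fun _ => 1 / p)
      (fun x _ => ((hasDerivAt_id x).div_const p).hasDerivWithinAt)
      (fun a _ b _ hab => by
        have : a / p = b / p := hab
        field_simp at this; exact this) (fun r => ENNReal.ofReal r * u (r • circleMap 0 1 θ))
    rw [himg] at hch
    have hL : ∫⁻ (x : ℝ) in Ioi 0, ENNReal.ofReal x •
        D.indicator u (Complex.polarCoord.symm (x, θ)) =
        ∫⁻ r in Ioo 0 (1/p), ENNReal.ofReal r * u (r • circleMap 0 1 θ) := by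
      rw [← lintegral_indicator measurableSet_Ioi, ← lintegral_indicator measurableSet_Ioo]
      refine lintegral_congr fun r => ?_
      have hr : Complex.polarCoord.symm (r, θ) = r • circleMap 0 1 θ := by
        rw [Complex.polarCoord_symm_apply]
        simp [circleMap, Complex.exp_mul_I, mul_add]
      by_cases h0 : 0 < r
      · rw [indicator_of_mem (show r ∈ Ioi 0 from h0), hr]
        have hm : r • circleMap 0 1 θ ∈ D ↔ r < 1 / p := by
          have h := setOfPred_gauge_lt_one_eq_self_of_isOpen hc h0D ho
          have h' : r • circleMap 0 1 θ ∈ D ↔ gauge D (r • circleMap 0 1 θ) < 1 := by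
            conv_lhs => rw [← h]
            rfl
          rw [h', gauge_smul_of_nonneg h0.le, smul_eq_mul, lt_div_iff₀ hp0]
        by_cases h3 : r < 1 / p
        · rw [indicator_of_mem (hm.2 h3), indicator_of_mem (show r ∈ Ioo 0 (1/p) from ⟨h0, h3⟩)]
          rfl
        · rw [indicator_of_notMem (fun h => h3 (hm.1 h)), indicator_of_notMem (fun h => h3 h.2)]
          simp
      · rw [indicator_of_notMem (by simpa using h0), indicator_of_notMem (fun h => h0 h.1)]
    rw [hL, hch]
    refine setLIntegral_congr_fun measurableSet_Ioo fun s hs => ?_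
    rw [← mul_assoc, ← ENNReal.ofReal_mul (abs_nonneg _), abs_of_pos (by positivity)]
    congr 2
    field_simp
  · refine Measurable.aemeasurable ?_
    refine Measurable.smul (ENNReal.measurable_ofReal.comp measurable_fst) ?_
    refine (hu.indicator hDm).comp ?_
    have : (fun x : ℝ × ℝ => Complex.polarCoord.symm x) =
        fun x : ℝ × ℝ => (x.1 : ℂ) * (Real.cos x.2 + Real.sin x.2 * Complex.I) := by
      ext x; rw [Complex.polarCoord_symm_apply]
    show Measurable (fun x : ℝ × ℝ => Complex.polarCoord.symm x)
    rw [this]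
    fun_prop

open Set Metric ENNReal in
lemma area_compare {D : Set ℂ} (hc : Convex ℝ D) (ho : IsOpen D) {ρ R : ℝ} (hρ : 0 < ρ)
    (hR : 0 < R) (h1 : ball 0 ρ ⊆ D) (h2 : D ⊆ closedBall 0 R) (u v : ℂ → ℝ≥0∞)
    (hu : Measurable u) (hv : Measurable v) (c : ℝ≥0∞)
    (huv : ∀ s ∈ Ioo (0:ℝ) 1, ∫⁻ θ in Ioo (-Real.pi) Real.pi,
        u ((s / gauge D (circleMap 0 1 θ)) • circleMap 0 1 θ) ≤
      c * ∫⁻ θ in Ioo (-Real.pi) Real.pi,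
        v ((s / gauge D (circleMap 0 1 θ)) • circleMap 0 1 θ)) :
    ∫⁻ w in D, u w ≤ ENNReal.ofReal (R ^ 2 / ρ ^ 2) * (c * ∫⁻ w in D, v w) := by
  rw [area_polar hc ho hρ hR h1 h2 u hu, area_polar hc ho hρ hR h1 h2 v hv]
  set p : ℝ → ℝ := fun θ => gauge D (circleMap 0 1 θ) with hp
  change ∫⁻ θ in Ioo (-Real.pi) Real.pi, ∫⁻ s in Ioo (0:ℝ) 1,
      ENNReal.ofReal (s / p θ ^ 2) * u ((s / p θ) • circleMap 0 1 θ) ≤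
      ENNReal.ofReal (R ^ 2 / ρ ^ 2) * (c * ∫⁻ θ in Ioo (-Real.pi) Real.pi, ∫⁻ s in Ioo (0:ℝ) 1,
      ENNReal.ofReal (s / p θ ^ 2) * v ((s / p θ) • circleMap 0 1 θ))
  have hpc : Continuous p := (fried_gauge_lip hc hρ h1).continuous
  have hpb := fried_gauge_bounds hρ hR h1 h2
  have hpR : ∀ θ, 1 / R ≤ p θ := fun θ => (hpb θ).1
  have hpρ : ∀ θ, p θ ≤ 1 / ρ := fun θ => (hpb θ).2
  have hp0 : ∀ θ, 0 < p θ := fun θ => lt_of_lt_of_le (by positivity) (hpR θ)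
  have hzm : Measurable fun x : ℝ × ℝ => (x.2 / p x.1) • circleMap 0 1 x.1 := by
    have := hpc.measurable
    have h3 : Measurable (circleMap 0 1) := (continuous_circleMap 0 1).measurable
    fun_prop
  have hR2 : ∀ θ, 1 / p θ ^ 2 ≤ R ^ 2 := by
    intro θ
    have := hp0 θ
    rw [div_le_iff₀ (by positivity), ← mul_pow]
    have := hpR θ
    rw [div_le_iff₀ hR] at this
    exact one_le_pow₀ (by linarith)
  have hρ2 : ∀ θ, ρ ^ 2 ≤ 1 / p θ ^ 2 := by
    intro θ
    have := hp0 θ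
    rw [le_div_iff₀ (by positivity), ← mul_pow]
    have := hpρ θ
    rw [le_div_iff₀ hρ] at this
    exact pow_le_one₀ (by positivity) (by linarith)
  have step1 : ∫⁻ θ in Ioo (-Real.pi) Real.pi, ∫⁻ s in Ioo (0:ℝ) 1,
      ENNReal.ofReal (s / p θ ^ 2) * u ((s / p θ) • circleMap 0 1 θ) ≤
      ∫⁻ θ in Ioo (-Real.pi) Real.pi, ∫⁻ s in Ioo (0:ℝ) 1,
      ENNReal.ofReal (s * R ^ 2) * u ((s / p θ) • circleMap 0 1 θ) := by
    refine lintegral_mono fun θ => setLIntegral_mono' measurableSet_Ioo fun s hs => ?_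
    gcongr
    have := hs.1
    rw [div_eq_mul_one_div]
    exact mul_le_mul_of_nonneg_left (hR2 θ) this.le
  have step3 : ∫⁻ θ in Ioo (-Real.pi) Real.pi, ∫⁻ s in Ioo (0:ℝ) 1,
      ENNReal.ofReal (s * ρ ^ 2) * v ((s / p θ) • circleMap 0 1 θ) ≤ 
      ∫⁻ θ in Ioo (-Real.pi) Real.pi, ∫⁻ s in Ioo (0:ℝ) 1,
      ENNReal.ofReal (s / p θ ^ 2) * v ((s / p θ) • circleMap 0 1 θ) := by
    refine lintegral_mono fun θ => setLIntegral_mono' measurableSet_Ioo fun s hs => ?_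
    gcongr
    have := hs.1
    rw [div_eq_mul_one_div s]
    exact mul_le_mul_of_nonneg_left (hρ2 θ) this.le
  refine step1.trans ?_
  refine le_trans ?_ (mul_le_mul_right (mul_le_mul_right step3 c) _)
  have hum : ∀ q : ℝ, Measurable fun x : ℝ × ℝ => 
      ENNReal.ofReal (x.2 * q ^ 2) * u ((x.2 / p x.1) • circleMap 0 1 x.1) := fun q =>
    (by fun_prop : Measurable fun x : ℝ × ℝ => ENNReal.ofReal (x.2 * q ^ 2)).mul (hu.comp hzm)
  have hvm : ∀ q : ℝ, Measurable fun x : ℝ × ℝ => 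
      ENNReal.ofReal (x.2 * q ^ 2) * v ((x.2 / p x.1) • circleMap 0 1 x.1) := fun q =>
    (by fun_prop : Measurable fun x : ℝ × ℝ => ENNReal.ofReal (x.2 * q ^ 2)).mul (hv.comp hzm)
  have sw1 := lintegral_lintegral_swap (μ := volume.restrict (Ioo (-Real.pi) Real.pi))
    (ν := volume.restrict (Ioo (0:ℝ) 1)) (f := fun θ s => ENNReal.ofReal (s * R ^ 2) *
      u ((s / p θ) • circleMap 0 1 θ)) (hum R).aemeasurable
  have sw2 := lintegral_lintegral_swap (μ := volume.restrict (Ioo (-Real.pi) Real.pi))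
    (ν := volume.restrict (Ioo (0:ℝ) 1)) (f := fun θ s => ENNReal.ofReal (s * ρ ^ 2) *
      v ((s / p θ) • circleMap 0 1 θ)) (hvm ρ).aemeasurable
  rw [sw1, sw2]
  have hum' : ∀ s : ℝ, Measurable fun θ : ℝ => u ((s / p θ) • circleMap 0 1 θ) := fun s =>
    hu.comp (hzm.comp (measurable_id.prodMk measurable_const))
  have hvm' : ∀ s : ℝ, Measurable fun θ : ℝ => v ((s / p θ) • circleMap 0 1 θ) := fun s =>
    hv.comp (hzm.comp (measurable_id.prodMk measurable_const))
  have hin : Measurable fun s : ℝ => ∫⁻ θ in Ioo (-Real.pi) Real.pi,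
      ENNReal.ofReal (s * ρ ^ 2) * v ((s / p θ) • circleMap 0 1 θ) :=
    ((hvm ρ).comp measurable_swap).lintegral_prod_right'
  rw [← lintegral_const_mul _ hin, ← lintegral_const_mul _ (hin.const_mul _)]
  refine setLIntegral_mono' measurableSet_Ioo fun s hs => ?_
  rw [lintegral_const_mul _ (hum' s), lintegral_const_mul _ (hvm' s)]
  have h3 : ENNReal.ofReal (s * R ^ 2) =
      ENNReal.ofReal (R ^ 2 / ρ ^ 2) * ENNReal.ofReal (s * ρ ^ 2) := by
    rw [← ENNReal.ofReal_mul (by positivity)]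
    congr 1
    field_simp
  rw [h3, mul_assoc]
  gcongr ENNReal.ofReal (R ^ 2 / ρ ^ 2) * ?_
  rw [mul_left_comm c]
  gcongr
  exact huv s hs

open Set Metric ENNReal in
/-- Friedrichs' inequality for conjugate harmonic functions on a convex domain. -/
lemma friedrichs {D : Set ℂ} (hc : Convex ℝ D) (ho : IsOpen D) {ρ R : ℝ} (hρ : 0 < ρ)
    (hR : 0 < R) (h1 : ball 0 ρ ⊆ D) (h2 : D ⊆ closedBall 0 R) (F : ℂ → ℂ)
    (hF : DifferentiableOn ℂ F D) :
    ∫⁻ w in D, ENNReal.ofReal (((F w).re - (F 0).re) ^ 2) ≤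
      ENNReal.ofReal (R ^ 2 / ρ ^ 2) * (ENNReal.ofReal (2 + 4 * (R / ρ) ^ 2) *
        ∫⁻ w in D, ENNReal.ofReal ((F w).im ^ 2)) := by
  have hDm : MeasurableSet D := ho.measurableSet
  set F1 : ℂ → ℂ := fun w => F w - (F 0).re with hF1
  have hF1d : DifferentiableOn ℂ F1 D := hF.sub_const _
  have hcon : ContinuousOn F1 D := hF1d.continuousOn
  set u : ℂ → ℝ≥0∞ := fun w => D.indicator (fun w => ENNReal.ofReal ((F1 w).re ^ 2)) w with hu
  set v : ℂ → ℝ≥0∞ := fun w => D.indicator (fun w => ENNReal.ofReal ((F1 w).im ^ 2)) w with hv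
  have hum : Measurable u :=
    measurable_indicator_of_continuousOn ho (ENNReal.continuous_ofReal.comp_continuousOn
      ((Complex.continuous_re.comp_continuousOn hcon).pow 2))
  have hvm : Measurable v :=
    measurable_indicator_of_continuousOn ho (ENNReal.continuous_ofReal.comp_continuousOn
      ((Complex.continuous_im.comp_continuousOn hcon).pow 2))
  have key := area_compare hc ho hρ hR h1 h2 u v hum hvm (ENNReal.ofReal (2 + 4 * (R / ρ) ^ 2)) ?_
  · have e1 : ∫⁻ w in D, u w = ∫⁻ w in D, ENNReal.ofReal (((F w).re - (F 0).re) ^ 2) := by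
      refine setLIntegral_congr_fun hDm fun w hw => ?_
      simp [hu, hw, hF1]
    have e2 : ∫⁻ w in D, v w = ∫⁻ w in D, ENNReal.ofReal ((F w).im ^ 2) := by
      refine setLIntegral_congr_fun hDm fun w hw => ?_
      simp [hv, hw, hF1]
    rwa [e1, e2] at key
  · intro s hs
    obtain ⟨hzc, hzD, hle⟩ := fried_boundary hc ho hρ hR h1 h2 F1 hF1d (by simp [hF1]) hs.1.le hs.2
      (fun θ => (s / gauge D (circleMap 0 1 θ)) • circleMap 0 1 θ) (fun _ => rfl)
    set z : ℝ → ℂ := fun θ => (s / gauge D (circleMap 0 1 θ)) • circleMap 0 1 θ with hz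
    have hfc : Continuous fun θ => F1 (z θ) := hcon.comp_continuous hzc hzD
    have hpi : -Real.pi ≤ Real.pi := by linarith [Real.pi_pos]
    have gen : ∀ f : ℝ → ℝ, Continuous f → ∫⁻ θ in Ioo (-Real.pi) Real.pi, ENNReal.ofReal (f θ ^ 2)
        = ENNReal.ofReal (∫ θ in (-Real.pi)..Real.pi, f θ ^ 2) := by
      intro f hf
      rw [intervalIntegral.integral_of_le hpi, ofReal_integral_eq_lintegral_ofReal]
      · exact (setLIntegral_congr Ioo_ae_eq_Ioc)
      · exact ((hf.pow 2).integrableOn_Icc).mono_set Ioc_subset_Icc_self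
      · exact Filter.Eventually.of_forall fun x => sq_nonneg _
    have e1 : ∫⁻ θ in Ioo (-Real.pi) Real.pi, u (z θ) =
        ∫⁻ θ in Ioo (-Real.pi) Real.pi, ENNReal.ofReal ((F1 (z θ)).re ^ 2) :=
      lintegral_congr fun θ => indicator_of_mem (hzD θ) _
    have e2 : ∫⁻ θ in Ioo (-Real.pi) Real.pi, v (z θ) =
        ∫⁻ θ in Ioo (-Real.pi) Real.pi, ENNReal.ofReal ((F1 (z θ)).im ^ 2) :=
      lintegral_congr fun θ => indicator_of_mem (hzD θ) _
    change ∫⁻ θ in Ioo (-Real.pi) Real.pi, u (z θ) ≤ _ * ∫⁻ θ in Ioo (-Real.pi) Real.pi, v (z θ)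
    rw [e1, e2, gen (fun θ => (F1 (z θ)).re) (Complex.continuous_re.comp hfc),
      gen (fun θ => (F1 (z θ)).im) (Complex.continuous_im.comp hfc),
      ← ENNReal.ofReal_mul (by positivity)]
    exact ENNReal.ofReal_le_ofReal hle

lemma hilbert_rep {V H : Type*} [AddCommGroup V] [Module ℝ V] [NormedAddCommGroup H]
    [InnerProductSpace ℝ H] [CompleteSpace H] (T : V →ₗ[ℝ] H) (L : V →ₗ[ℝ] ℝ) (M : ℝ)
    (hM : 0 ≤ M) (h : ∀ v, |L v| ≤ M * ‖T v‖) :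
    ∃ g : H, ‖g‖ ≤ M ∧ ∀ v, L v = inner ℝ g (T v) := by
  have hker : LinearMap.ker T ≤ LinearMap.ker L := by
    intro v hv
    have h1 := h v
    rw [LinearMap.mem_ker.1 hv, norm_zero, mul_zero] at h1
    exact LinearMap.mem_ker.2 (abs_nonpos_iff.1 h1)
  obtain ⟨L', hL'⟩ : ∃ L' : LinearMap.range T →ₗ[ℝ] ℝ, ∀ v, L' (T.rangeRestrict v) = L v := by
    refine ⟨((LinearMap.ker T).liftQ L hker) ∘ₗ T.quotKerEquivRange.symm.toLinearMap, fun v => ?_⟩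
    have : T.quotKerEquivRange.symm (T.rangeRestrict v) = (LinearMap.ker T).mkQ v := by
      rw [LinearEquiv.symm_apply_eq]; rfl
    simp [this]
  let Lc : LinearMap.range T →L[ℝ] ℝ := L'.mkContinuous M (by
    rintro ⟨_, v, rfl⟩
    have := h v
    rw [← hL' v] at this
    exact this)
  obtain ⟨Le, hLe, hn⟩ := exists_extension_norm_eq (𝕜 := ℝ) (LinearMap.range T) Lc
  refine ⟨(InnerProductSpace.toDual ℝ H).symm Le, ?_, fun v => ?_⟩
  · rw [LinearIsometryEquiv.norm_map, hn]
    exact LinearMap.mkContinuous_norm_le _ hM _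
  · rw [InnerProductSpace.toDual_symm_apply, ← hL' v]
    exact (hLe (T.rangeRestrict v)).symm

lemma E2_eq (v : E2) : v = v 0 • EuclideanSpace.single 0 (1:ℝ) + v 1 • EuclideanSpace.single 1 (1:ℝ) := by
  ext i; fin_cases i <;> simp

lemma fderiv_E2 (f : E2 → ℝ) (x v : E2) : fderiv ℝ f x v = v 0 * pd 0 f x + v 1 * pd 1 f x := by
  conv_lhs => rw [E2_eq v]
  simp [pd]

lemma exists_potential {Ω : Set E2} (hconv : Convex ℝ Ω) (hopen : IsOpen Ω)
    (τ : E2 → Fin 2 → ℝ) (hτ : ∀ i, ContDiffOn ℝ (⊤ : ℕ∞) (fun x => τ x i) Ω)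
    (hdiv : ∀ x ∈ Ω, pd 0 (fun y => τ y 0) x + pd 1 (fun y => τ y 1) x = 0) :
    ∃ ω : E2 → ℝ, ContDiffOn ℝ (⊤ : ℕ∞) ω Ω ∧
      ∀ x ∈ Ω, pd 1 ω x = τ x 0 ∧ -(pd 0 ω x) = τ x 1 := by
  let P : Fin 2 → (E2 →L[ℝ] ℝ) := fun i => EuclideanSpace.proj i
  let A : E2 → (E2 →L[ℝ] ℝ) := fun x => τ x 0 • P 1 - τ x 1 • P 0
  have hA : ContDiffOn ℝ (⊤ : ℕ∞) A Ω :=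
    ((hτ 0).smul contDiffOn_const).sub ((hτ 1).smul contDiffOn_const)
  have hd : ∀ i, ∀ x ∈ Ω, DifferentiableAt ℝ (fun y => τ y i) x := fun i x hx =>
    ((hτ i).differentiableOn (by simp)).differentiableAt (hopen.mem_nhds hx)
  obtain ⟨ω, hω⟩ := hconv.exists_forall_hasFDerivAt_of_fderiv_symmetric hopen (ω := A)
    (hA.differentiableOn (by simp)) (by
      intro a ha v w
      have h1 : HasFDerivAt A ((fderiv ℝ (fun y => τ y 0) a).smulRight (P 1) -
          (fderiv ℝ (fun y => τ y 1) a).smulRight (P 0)) a :=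
        ((hd 0 a ha).hasFDerivAt.smul_const (P 1)).sub ((hd 1 a ha).hasFDerivAt.smul_const (P 0))
      rw [h1.fderiv]
      have := hdiv a ha
      have hP : ∀ i (v : E2), P i v = v i := fun _ _ => rfl
      simp only [sub_apply, ContinuousLinearMap.smulRight_apply, fderiv_E2,
        smul_apply, hP, smul_eq_mul]
      linear_combination (v 0 * w 1 - v 1 * w 0) * this)
  refine ⟨ω, ?_, fun x hx => ?_⟩
  · have hdω : DifferentiableOn ℝ ω Ω := fun x hx => (hω x hx).differentiableAt.differentiableWithinAt
    rw [contDiffOn_infty_iff_fderiv_of_isOpen hopen]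
    exact ⟨hdω, hA.congr fun x hx => (hω x hx).fderiv⟩
  · simp [pd, (hω x hx).fderiv, A, P]

section test
variable {Ω : Set E2}

lemma cont_mul {u g : E2 → ℝ} (hopen : IsOpen Ω) (hu : ContinuousOn u Ω) (hg : Continuous g)
    (hts : tsupport g ⊆ Ω) : Continuous fun x => u x * g x := by
  refine continuous_of_tsupport fun x hx => ?_
  have hx' : x ∈ Ω := hts (tsupport_mul_subset_right hx)
  exact (hu.continuousAt (hopen.mem_nhds hx')).mul hg.continuousAt

lemma int_mul {u g : E2 → ℝ} (hopen : IsOpen Ω) (hu : ContinuousOn u Ω) (hg : Continuous g)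
    (hcs : HasCompactSupport g) (hts : tsupport g ⊆ Ω) : Integrable fun x => u x * g x :=
  (cont_mul hopen hu hg hts).integrable_of_hasCompactSupport hcs.mul_left

lemma pd_cont {g : E2 → ℝ} (hg : ContDiff ℝ (⊤ : ℕ∞) g) (i : Fin 2) : Continuous (pd i g) :=
  (hg.continuous_fderiv (by simp)).clm_apply continuous_const

lemma pd_smooth {g : E2 → ℝ} (hg : ContDiff ℝ (⊤ : ℕ∞) g) (i : Fin 2) :
    ContDiff ℝ (⊤ : ℕ∞) (pd i g) :=
  (hg.fderiv_right (m := (⊤ : ℕ∞)) (by simp)).clm_apply contDiff_const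

lemma pd_tsupport (g : E2 → ℝ) (i : Fin 2) : tsupport (pd i g) ⊆ tsupport g :=
  tsupport_fderiv_apply_subset ℝ _

lemma pd_hcs {g : E2 → ℝ} (hg : HasCompactSupport g) (i : Fin 2) : HasCompactSupport (pd i g) :=
  hg.of_isClosed_subset (isClosed_tsupport _) (pd_tsupport g i)

lemma ibp {u g : E2 → ℝ} (hopen : IsOpen Ω) (hu : ContDiffOn ℝ (⊤ : ℕ∞) u Ω)
    (hg : ContDiff ℝ (⊤ : ℕ∞) g) (hcs : HasCompactSupport g) (hts : tsupport g ⊆ Ω) (i : Fin 2) :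
    ∫ x, pd i u x * g x = - ∫ x, u x * pd i g x := by
  have hpu : ContinuousOn (pd i u) Ω :=
    (hu.continuousOn_fderiv_of_isOpen hopen (by simp)).clm_apply continuousOn_const
  have h := integral_mul_fderiv_eq_neg_fderiv_mul_of_integrable (𝕜 := ℝ) (μ := volume)
    (f := g) (g := u) (v := EuclideanSpace.single i (1:ℝ)) ?_ ?_ ?_ ?_ ?_
  · simp only [pd]
    simp only [mul_comm (g _)] at h
    rw [h]
    simp only [mul_comm]
  · simpa only [mul_comm, pd] using int_mul hopen hu.continuousOn (pd_cont hg i) (pd_hcs hcs i)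
      ((pd_tsupport g i).trans hts)
  · simpa only [mul_comm, pd] using int_mul hopen hpu hg.continuous hcs hts
  · simpa only [mul_comm] using int_mul hopen hu.continuousOn hg.continuous hcs hts
  · exact fun x _ => (hg.differentiable (by simp)) x
  · exact fun x hx => (hu.differentiableOn (by simp)).differentiableAt (hopen.mem_nhds (hts hx))

lemma pd_comm {g : E2 → ℝ} (hg : ContDiff ℝ (⊤ : ℕ∞) g) (i j : Fin 2) :
    pd i (pd j g) = pd j (pd i g) := by
  ext x
  have hd : DifferentiableAt ℝ (fderiv ℝ g) x :=
    (hg.fderiv_right (m := (⊤ : ℕ∞)) (by simp)).differentiable (by simp) x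
  have key : ∀ i j, pd i (pd j g) x = fderiv ℝ (fderiv ℝ g) x (EuclideanSpace.single i 1)
      (EuclideanSpace.single j 1) := by
    intro i j
    have := hd.hasFDerivAt.clm_apply (hasFDerivAt_const (EuclideanSpace.single j (1:ℝ)) x)
    unfold pd
    rw [this.fderiv]
    simp
  rw [key, key]
  have hs : IsSymmSndFDerivAt ℝ g x := hg.contDiffAt.isSymmSndFDerivAt (by simp; exact WithTop.coe_le_coe.2 (le_top : (2:ℕ∞) ≤ ⊤))
  exact hs _ _

lemma det_null {f g : E2 → ℝ} (hf : ContDiff ℝ (⊤ : ℕ∞) f) (hg : ContDiff ℝ (⊤ : ℕ∞) g)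
    (hcg : HasCompactSupport g) :
    ∫ x, pd 0 f x * pd 1 g x = ∫ x, pd 1 f x * pd 0 g x := by
  rw [ibp isOpen_univ hf.contDiffOn (pd_smooth hg 1) (pd_hcs hcg 1) (Set.subset_univ _),
    ibp isOpen_univ hf.contDiffOn (pd_smooth hg 0) (pd_hcs hcg 0) (Set.subset_univ _),
    pd_comm hg]
end test

def curlS (φ : E2 → Fin 2 → ℝ) (x : E2) : ℝ := pd 0 (fun y => φ y 1) x - pd 1 (fun y => φ y 0) x
def divS (φ : E2 → Fin 2 → ℝ) (x : E2) : ℝ := pd 0 (fun y => φ y 0) x + pd 1 (fun y => φ y 1) x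

structure IsTest (Ω : Set E2) (φ : E2 → Fin 2 → ℝ) : Prop where
  smooth : ∀ i, ContDiff ℝ (⊤ : ℕ∞) (fun x => φ x i)
  hcs : HasCompactSupport φ
  ts : tsupport φ ⊆ Ω

lemma comp_tsupport (φ : E2 → Fin 2 → ℝ) (i : Fin 2) : tsupport (fun x => φ x i) ⊆ tsupport φ :=
  closure_mono fun x hx h => hx (by simp [h])

lemma IsTest.hcs_comp {Ω : Set E2} {φ : E2 → Fin 2 → ℝ} (h : IsTest Ω φ) (i : Fin 2) :
    HasCompactSupport (fun x => φ x i) :=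
  h.hcs.of_isClosed_subset (isClosed_tsupport _) (comp_tsupport φ i)

lemma IsTest.ts_comp {Ω : Set E2} {φ : E2 → Fin 2 → ℝ} (h : IsTest Ω φ) (i : Fin 2) :
    tsupport (fun x => φ x i) ⊆ Ω := (comp_tsupport φ i).trans h.ts

lemma pd_add {f g : E2 → ℝ} (hf : ContDiff ℝ (⊤ : ℕ∞) f) (hg : ContDiff ℝ (⊤ : ℕ∞) g) (i : Fin 2)
    (x : E2) : pd i (fun y => f y + g y) x = pd i f x + pd i g x := by
  unfold pd
  rw [fderiv_fun_add (hf.differentiable (by simp) x) (hg.differentiable (by simp) x)]; rfl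

lemma pd_smul {f : E2 → ℝ} (hf : ContDiff ℝ (⊤ : ℕ∞) f) (c : ℝ) (i : Fin 2)
    (x : E2) : pd i (fun y => c * f y) x = c * pd i f x := by
  unfold pd
  rw [fderiv_const_mul (hf.differentiable (by simp) x)]; rfl

lemma IsTest.add {Ω : Set E2} {φ ψ : E2 → Fin 2 → ℝ} (h : IsTest Ω φ) (h' : IsTest Ω ψ) :
    IsTest Ω (φ + ψ) :=
  ⟨fun i => (h.smooth i).add (h'.smooth i), h.hcs.add h'.hcs,
    (tsupport_add φ ψ).trans (Set.union_subset h.ts h'.ts)⟩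

lemma IsTest.smul {Ω : Set E2} {φ : E2 → Fin 2 → ℝ} (h : IsTest Ω φ) (c : ℝ) :
    IsTest Ω (c • φ) := by
  have hs : tsupport (c • φ) ⊆ tsupport φ := closure_mono fun x hx h => hx (by simp [h])
  exact ⟨fun i => contDiff_const.mul (h.smooth i), h.hcs.of_isClosed_subset (isClosed_tsupport _) hs,
    hs.trans h.ts⟩

def testSub (Ω : Set E2) : Submodule ℝ (E2 → Fin 2 → ℝ) where
  carrier := {φ | IsTest Ω φ}
  add_mem' h h' := IsTest.add h h'
  zero_mem' := ⟨fun i => contDiff_const, HasCompactSupport.zero, by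
    simp [tsupport]⟩
  smul_mem' c _ h := IsTest.smul h c

def cdv (φ : E2 → Fin 2 → ℝ) (x : E2) : E2 := !₂[curlS φ x, divS φ x]

lemma cdv_cont {Ω : Set E2} {φ : E2 → Fin 2 → ℝ} (h : IsTest Ω φ) : Continuous (cdv φ) := by
  unfold cdv curlS divS
  have := fun i j => pd_cont (h.smooth i) j
  refine (PiLp.continuous_toLp 2 _).comp (continuous_pi fun i => ?_)
  fin_cases i
  · exact (this 1 0).sub (this 0 1)
  · exact (this 0 0).add (this 1 1)

lemma pd_zero_off (φ : E2 → Fin 2 → ℝ) (i j : Fin 2) {x : E2} (hx : x ∉ tsupport φ) :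
    pd j (fun y => φ y i) x = 0 :=
  image_eq_zero_of_notMem_tsupport fun h => hx (comp_tsupport φ i (pd_tsupport _ j h))

lemma cdv_zero_off (φ : E2 → Fin 2 → ℝ) {x : E2} (hx : x ∉ tsupport φ) : cdv φ x = 0 := by
  ext i; fin_cases i <;> simp [cdv, curlS, divS, pd_zero_off φ _ _ hx]

lemma cdv_hcs {Ω : Set E2} {φ : E2 → Fin 2 → ℝ} (h : IsTest Ω φ) : HasCompactSupport (cdv φ) :=
  HasCompactSupport.intro h.hcs fun _ hx => cdv_zero_off φ hx

lemma cdv_add {Ω : Set E2} {φ ψ : E2 → Fin 2 → ℝ} (h : IsTest Ω φ) (h' : IsTest Ω ψ) :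
    cdv (φ + ψ) = cdv φ + cdv ψ := by
  have key : ∀ i j x, pd j (fun y => (φ + ψ) y i) x = pd j (fun y => φ y i) x + pd j (fun y => ψ y i) x :=
    fun i j x => pd_add (h.smooth i) (h'.smooth i) j x
  ext x i; fin_cases i <;> simp only [cdv, curlS, divS, key] <;> simp [cdv, curlS, divS] <;> ring

lemma cdv_smul {Ω : Set E2} {φ : E2 → Fin 2 → ℝ} (h : IsTest Ω φ) (c : ℝ) :
    cdv (c • φ) = c • cdv φ := by
  have key : ∀ i j x, pd j (fun y => (c • φ) y i) x = c * pd j (fun y => φ y i) x :=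
    fun i j x => pd_smul (h.smooth i) c j x
  ext x i; fin_cases i <;> simp only [cdv, curlS, divS, key] <;> simp [cdv, curlS, divS] <;> ring

lemma frob_eq {Ω : Set E2} {φ : E2 → Fin 2 → ℝ} (h : IsTest Ω φ) :
    ∫ x in Ω, frob (jac φ x) (jac φ x) = ∫ x in Ω, ‖cdv φ x‖ ^ 2 := by
  rw [setIntegral_eq_integral_of_forall_compl_eq_zero, setIntegral_eq_integral_of_forall_compl_eq_zero]
  · have hitg : ∀ i j i' j', Integrable fun x => pd j (fun y => φ y i) x * pd j' (fun y => φ y i') x :=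
      fun i j i' j' => ((pd_cont (h.smooth i) j).mul (pd_cont (h.smooth i') j')).integrable_of_hasCompactSupport
        (pd_hcs (h.hcs_comp i') j').mul_left
    have e : ∀ x, ‖cdv φ x‖^2 = frob (jac φ x) (jac φ x) + 2 *
       (pd 0 (fun y => φ y 0) x * pd 1 (fun y => φ y 1) x - pd 1 (fun y => φ y 0) x * pd 0 (fun y => φ y 1) x) := by
      intro x
      rw [EuclideanSpace.norm_sq_eq]
      simp [cdv, frob, jac, curlS, divS]
      ring
    simp_rw [e]
    rw [integral_add, integral_const_mul, integral_sub (hitg _ _ _ _) (hitg _ _ _ _),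
      det_null (h.smooth 0) (h.smooth 1) (h.hcs_comp 1), sub_self, mul_zero, add_zero]
    · unfold frob jac
      exact integrable_finsetSum _ fun i _ => integrable_finsetSum _ fun j _ => hitg i j i j
    · exact ((hitg _ _ _ _).sub (hitg _ _ _ _)).const_mul 2
  · intro x hx
    simp [cdv_zero_off φ fun h' => hx (h.ts h')]
  · intro x hx
    simp [frob, jac, pd_zero_off φ _ _ fun h' => hx (h.ts h')]

lemma pair_eq {Ω : Set E2} (hopen : IsOpen Ω) {ω : E2 → ℝ} (hω : ContDiffOn ℝ (⊤ : ℕ∞) ω Ω)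
    {τ : E2 → Fin 2 → ℝ} (hτ : ∀ x ∈ Ω, pd 1 ω x = τ x 0 ∧ -(pd 0 ω x) = τ x 1)
    {φ : E2 → Fin 2 → ℝ} (h : IsTest Ω φ) :
    ∫ x in Ω, ∑ i, τ x i * φ x i = ∫ x in Ω, ω x * curlS φ x := by
  have h1 : ∫ x in Ω, ∑ i, τ x i * φ x i =
      ∫ x in Ω, (pd 1 ω x * φ x 0 - pd 0 ω x * φ x 1) := by
    refine setIntegral_congr_fun hopen.measurableSet fun x hx => ?_
    simp [← (hτ x hx).1, ← (hτ x hx).2]; ring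
  have hpu : ∀ i, ContinuousOn (pd i ω) Ω := fun i =>
    (hω.continuousOn_fderiv_of_isOpen hopen (by simp)).clm_apply continuousOn_const
  rw [h1, setIntegral_eq_integral_of_forall_compl_eq_zero, setIntegral_eq_integral_of_forall_compl_eq_zero,
    integral_sub, ibp hopen hω (h.smooth 0) (h.hcs_comp 0) (h.ts_comp 0),
    ibp hopen hω (h.smooth 1) (h.hcs_comp 1) (h.ts_comp 1)]
  · simp only [curlS, mul_sub]
    rw [integral_sub]
    · ring
    · exact int_mul hopen hω.continuousOn (pd_cont (h.smooth 1) 0) (pd_hcs (h.hcs_comp 1) 0)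
        ((pd_tsupport _ _).trans (h.ts_comp 1))
    · exact int_mul hopen hω.continuousOn (pd_cont (h.smooth 0) 1) (pd_hcs (h.hcs_comp 0) 1)
        ((pd_tsupport _ _).trans (h.ts_comp 0))
  · exact int_mul hopen (hpu 1) (h.smooth 0).continuous (h.hcs_comp 0) (h.ts_comp 0)
  · exact int_mul hopen (hpu 0) (h.smooth 1).continuous (h.hcs_comp 1) (h.ts_comp 1)
  · intro x hx
    simp [curlS, pd_zero_off φ _ _ fun h' => hx (h.ts h')]
  · intro x hx
    have : φ x = 0 := image_eq_zero_of_notMem_tsupport fun h' => hx (h.ts h')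
    simp [this]

lemma pair_int {Ω : Set E2} (hopen : IsOpen Ω) {ω : E2 → ℝ} (hω : ContDiffOn ℝ (⊤ : ℕ∞) ω Ω)
    {φ : E2 → Fin 2 → ℝ} (h : IsTest Ω φ) : Integrable fun x => ω x * curlS φ x := by
  have a := int_mul hopen hω.continuousOn (pd_cont (h.smooth 1) 0) (pd_hcs (h.hcs_comp 1) 0)
        ((pd_tsupport _ _).trans (h.ts_comp 1))
  have b := int_mul hopen hω.continuousOn (pd_cont (h.smooth 0) 1) (pd_hcs (h.hcs_comp 0) 1)
        ((pd_tsupport _ _).trans (h.ts_comp 0))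
  simp only [curlS, mul_sub]
  exact a.sub b

lemma exists_rep {Ω : Set E2} (hopen : IsOpen Ω) {ω : E2 → ℝ} (hω : ContDiffOn ℝ (⊤ : ℕ∞) ω Ω)
    {τ : E2 → Fin 2 → ℝ} (hτ : ∀ x ∈ Ω, pd 1 ω x = τ x 0 ∧ -(pd 0 ω x) = τ x 1)
    {M : ℝ} (hM : 0 ≤ M)
    (hyp : ∀ φ : E2 → Fin 2 → ℝ,
          (∀ i, ContDiff ℝ (⊤ : ℕ∞) (fun x => φ x i)) →
          HasCompactSupport φ → tsupport φ ⊆ Ω →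
          (∫ x in Ω, frob (jac φ x) (jac φ x)) ≤ 1 →
          (∫ x in Ω, ∑ i, τ x i * φ x i) ≤ M) :
    ∃ G : E2 → E2, MemLp G 2 (volume.restrict Ω) ∧
      ∫⁻ x in Ω, ENNReal.ofReal (‖G x‖ ^ 2) ≤ ENNReal.ofReal (M ^ 2) ∧
      ∀ φ, IsTest Ω φ → ∫ x in Ω, ω x * curlS φ x =
        ∫ x in Ω, (G x 0 * curlS φ x + G x 1 * divS φ x) := by
  set μ := volume.restrict Ω
  have hmem : ∀ φ, IsTest Ω φ → MemLp (cdv φ) 2 μ := fun φ h =>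
    ((cdv_cont h).memLp_of_hasCompactSupport (cdv_hcs h)).restrict Ω
  let T : testSub Ω →ₗ[ℝ] Lp E2 2 μ :=
    { toFun := fun φ => (hmem φ φ.2).toLp
      map_add' := fun φ ψ => by
        rw [← MemLp.toLp_add]
        congr 1
        exact cdv_add φ.2 ψ.2
      map_smul' := fun c φ => by
        rw [RingHom.id_apply, ← MemLp.toLp_const_smul]
        congr 1
        exact cdv_smul φ.2 c }
  let L : testSub Ω →ₗ[ℝ] ℝ :=
    { toFun := fun φ => ∫ x in Ω, ω x * curlS φ x
      map_add' := fun φ ψ => by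
        rw [← integral_add (pair_int hopen hω φ.2).restrict (pair_int hopen hω ψ.2).restrict]
        congr 1; ext x
        have := congrArg (fun v : E2 => v 0) (congrFun (cdv_add φ.2 ψ.2) x)
        simp [cdv] at this
        simp [this]; ring
      map_smul' := fun c φ => by
        rw [RingHom.id_apply, smul_eq_mul, ← integral_const_mul]
        congr 1; ext x
        have := congrArg (fun v : E2 => v 0) (congrFun (cdv_smul φ.2 c) x)
        simp [cdv] at this
        simp [this]; ring }
  have hTn : ∀ φ : testSub Ω, ‖T φ‖ ^ 2 = ∫ x in Ω, frob (jac φ x) (jac φ x) := by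
    intro φ
    rw [frob_eq φ.2, ← real_inner_self_eq_norm_sq, L2.inner_def]
    refine integral_congr_ae ?_
    filter_upwards [(hmem φ φ.2).coeFn_toLp] with x hx
    simp only [T, LinearMap.coe_mk, AddHom.coe_mk, hx, real_inner_self_eq_norm_sq]
  have hL1 : ∀ φ : testSub Ω, ‖T φ‖ ≤ 1 → L φ ≤ M := by
    intro φ h
    have := hyp φ φ.2.smooth φ.2.hcs φ.2.ts (by
      rw [← hTn]; exact pow_le_one₀ (norm_nonneg _) h)
    rwa [pair_eq hopen hω hτ φ.2] at this
  have hL2 : ∀ φ : testSub Ω, L φ ≤ M * ‖T φ‖ := by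
    intro φ
    have : ∀ ε > 0, L φ ≤ M * (‖T φ‖ + ε) := by
      intro ε hε
      have hp : 0 < ‖T φ‖ + ε := by positivity
      have := hL1 ((‖T φ‖ + ε)⁻¹ • φ) (by
        rw [map_smul, norm_smul, norm_inv, Real.norm_of_nonneg hp.le, inv_mul_le_iff₀ hp]
        linarith)
      rw [map_smul, smul_eq_mul, inv_mul_le_iff₀ hp] at this
      linarith
    have ht : Filter.Tendsto (fun ε => M * (‖T φ‖ + ε)) (nhdsWithin 0 (Set.Ioi 0)) (nhds (M * (‖T φ‖ + 0))) :=
      ((continuous_const.mul (continuous_const.add continuous_id)).tendsto (0:ℝ)).mono_left nhdsWithin_le_nhds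
    rw [add_zero] at ht
    exact ge_of_tendsto ht (by filter_upwards [self_mem_nhdsWithin] with ε hε using this ε hε)
  obtain ⟨g, hg, hrep⟩ := hilbert_rep T L M hM (fun φ => by
    refine abs_le.2 ⟨?_, hL2 φ⟩
    have := hL2 (-φ)
    rw [map_neg, map_neg, norm_neg] at this
    linarith)
  refine ⟨g, Lp.memLp g, ?_, fun φ h => ?_⟩
  · rw [← ofReal_integral_eq_lintegral_ofReal]
    · refine ENNReal.ofReal_le_ofReal ?_
      have : ‖g‖ ^ 2 = ∫ x in Ω, ‖g x‖ ^ 2 := by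
        rw [← real_inner_self_eq_norm_sq, L2.inner_def]
        simp only [real_inner_self_eq_norm_sq, μ]
      rw [← this]
      gcongr
    · exact (Lp.memLp g).integrable_norm_pow (by norm_num)
    · exact Filter.Eventually.of_forall fun x => by positivity
  · have := hrep ⟨φ, h⟩
    rw [L2.inner_def] at this
    refine this.trans (integral_congr_ae ?_)
    filter_upwards [(hmem φ h).coeFn_toLp] with x hx
    simp only [T, LinearMap.coe_mk, AddHom.coe_mk, hx, PiLp.inner_apply]
    simp [cdv, mul_comm]

lemma friedrichs_E2 {D : Set E2} (hc : Convex ℝ D) (ho : IsOpen D) {x0 : E2} {ρ R : ℝ} (hρ : 0 < ρ)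
    (hR : 0 < R) (h1 : Metric.ball x0 ρ ⊆ D) (h2 : D ⊆ Metric.closedBall x0 R) (a b : E2 → ℝ)
    (ha : ∀ x ∈ D, DifferentiableAt ℝ a x) (hb : ∀ x ∈ D, DifferentiableAt ℝ b x)
    (cr1 : ∀ x ∈ D, pd 0 a x = pd 1 b x) (cr2 : ∀ x ∈ D, pd 1 a x = - pd 0 b x) :
    ∫⁻ x in D, ENNReal.ofReal ((a x - a x0) ^ 2) ≤ ENNReal.ofReal (R ^ 2 / ρ ^ 2) *
      (ENNReal.ofReal (2 + 4 * (R / ρ) ^ 2) * ∫⁻ x in D, ENNReal.ofReal (b x ^ 2)) := by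
  let e : ℂ ≃ₗᵢ[ℝ] E2 := Complex.orthonormalBasisOneI.repr
  have he : ∀ z : ℂ, e z = z.re • EuclideanSpace.single 0 (1:ℝ) + z.im • EuclideanSpace.single 1 (1:ℝ) := by
    intro z
    ext i; fin_cases i <;> simp [e]
  let Φ : ℂ → E2 := fun z => x0 + e z
  have hΦm : MeasurePreserving Φ := (measurePreserving_add_left volume x0).comp e.measurePreserving
  have hΦe : MeasurableEmbedding Φ :=
    (MeasurableEquiv.addLeft x0).measurableEmbedding.comp e.toMeasurableEquiv.measurableEmbedding
  have hΦd : ∀ z, HasFDerivAt Φ (e.toContinuousLinearEquiv : ℂ →L[ℝ] E2) z := fun z =>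
    (e.toContinuousLinearEquiv : ℂ →L[ℝ] E2).hasFDerivAt.const_add x0
  have hΦ0 : Φ 0 = x0 := by simp [Φ]
  have hdist : ∀ z, dist (Φ z) x0 = dist z 0 := fun z => by simp [Φ, dist_eq_norm]
  have hcD : Convex ℝ (Φ ⁻¹' D) := by
    have : Φ ⁻¹' D = e.toContinuousLinearEquiv.toLinearMap ⁻¹' ((fun y => x0 + y) ⁻¹' D) := rfl
    rw [this]
    exact (hc.translate_preimage_right x0).linear_preimage _
  have hoD : IsOpen (Φ ⁻¹' D) := ho.preimage (continuous_const.add e.continuous)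
  let F : ℂ → ℂ := fun z => (a (Φ z) : ℂ) + (b (Φ z) : ℂ) * Complex.I
  have hF : DifferentiableOn ℂ F (Φ ⁻¹' D) := by
    intro z hz
    have hda := ((ha _ hz).hasFDerivAt.comp z (hΦd z))
    have hdb := ((hb _ hz).hasFDerivAt.comp z (hΦd z))
    have hda' := (Complex.ofRealCLM.hasFDerivAt).comp z hda
    have hdb' := (Complex.ofRealCLM.hasFDerivAt).comp z hdb
    have hd := hda'.add (hdb'.mul_const Complex.I)
    refine (DifferentiableAt.differentiableWithinAt ?_)
    refine (differentiableAt_complex_iff_differentiableAt_real.2 ⟨?_, ?_⟩)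
    · exact hd.differentiableAt
    · have hd' : HasFDerivAt F _ z := hd
      rw [hd'.fderiv]
      have c1 := cr1 _ hz
      have c2 := cr2 _ hz
      simp [he]
      simp only [pd] at c1 c2
      rw [c1, c2]
      apply Complex.ext <;> simp
  have := friedrichs hcD hoD hρ hR (fun z hz => h1 (by simpa [hdist] using hz))
    (fun z hz => by simpa [hdist] using h2 hz) F hF
  have e1 : ∫⁻ w in Φ ⁻¹' D, ENNReal.ofReal (((F w).re - (F 0).re) ^ 2) =
      ∫⁻ x in D, ENNReal.ofReal ((a x - a x0) ^ 2) := by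
    rw [← hΦm.setLIntegral_comp_preimage_emb hΦe]
    simp [F, hΦ0]
  have e2 : ∫⁻ w in Φ ⁻¹' D, ENNReal.ofReal ((F w).im ^ 2) =
      ∫⁻ x in D, ENNReal.ofReal (b x ^ 2) := by
    rw [← hΦm.setLIntegral_comp_preimage_emb hΦe]
    simp [F]
  rwa [e1, e2] at this

/-- mollification -/
def mol (k f : E2 → ℝ) : E2 → ℝ :=
  MeasureTheory.convolution f k (ContinuousLinearMap.lsmul ℝ ℝ) volume

lemma mol_apply (k f : E2 → ℝ) (x : E2) : mol k f x = ∫ t, f t * k (x - t) := rfl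

lemma mol_deriv {k f : E2 → ℝ} (hk : ContDiff ℝ (⊤ : ℕ∞) k) (hkc : HasCompactSupport k)
    (hf : LocallyIntegrable f) (x : E2) :
    DifferentiableAt ℝ (mol k f) x ∧ ∀ i, pd i (mol k f) x = ∫ t, f t * pd i k (x - t) := by
  have h := hkc.hasFDerivAt_convolution_right (ContinuousLinearMap.lsmul ℝ ℝ) hf
    (hk.of_le (by simp : (1 : WithTop ℕ∞) ≤ _)) x
  refine ⟨h.differentiableAt, fun i => ?_⟩
  have h' : HasFDerivAt (mol k f) _ x := h
  rw [pd, h'.fderiv, convolution_precompR_apply _ hf (hkc.fderiv ℝ) (hk.continuous_fderiv (by simp))]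
  rfl

lemma mul_bdd_int {k f : E2 → ℝ} (hk : Continuous k) (hkc : HasCompactSupport k)
    (hf : LocallyIntegrable f) (x : E2) : Integrable fun t => f t * k (x - t) := by
  exact hkc.convolutionExists_right (ContinuousLinearMap.lsmul ℝ ℝ) hf hk x

lemma mol_sq_le {k f : E2 → ℝ} (hk : Continuous k) (hkc : HasCompactSupport k) (hk0 : ∀ x, 0 ≤ k x)
    (hk1 : ∫ x, k x = 1) (hf : Integrable f) (hf2 : Integrable fun x => f x ^ 2) (x : E2) :
    mol k f x ^ 2 ≤ mol k (fun y => f y ^ 2) x := by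
  have i1 := mul_bdd_int hk hkc hf.locallyIntegrable x
  have i2 := mul_bdd_int hk hkc hf2.locallyIntegrable x
  have ik : Integrable fun t => k (x - t) := (hk.integrable_of_hasCompactSupport hkc).comp_sub_left x
  have ek : ∫ t, k (x - t) = 1 := by rw [integral_sub_left_eq_self, hk1]
  set c := mol k f x with hc
  rw [mol_apply] at hc
  have : ∫ t, (2 * c * (f t * k (x - t))) ≤ ∫ t, (c ^ 2 * k (x - t) + f t ^ 2 * k (x - t)) := by
    refine integral_mono (i1.const_mul _) ((ik.const_mul _).add i2) fun t => ?_
    have := mul_nonneg (sq_nonneg (c - f t)) (hk0 (x - t))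
    nlinarith
  rw [integral_const_mul, integral_add (ik.const_mul _) i2, integral_const_mul, ek, ← hc] at this
  rw [mol_apply]
  linarith

lemma mol_L2 {k f : E2 → ℝ} (hk : Continuous k) (hkc : HasCompactSupport k) (hk0 : ∀ x, 0 ≤ k x)
    (hk1 : ∫ x, k x = 1) (hf : Integrable f) (hf2 : Integrable fun x => f x ^ 2) (D : Set E2) :
    ∫⁻ x in D, ENNReal.ofReal (mol k f x ^ 2) ≤ ENNReal.ofReal (∫ x, f x ^ 2) := by
  have hki : Integrable k volume := hk.integrable_of_hasCompactSupport hkc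
  have hI : Integrable (mol k fun y => f y ^ 2) :=
    hf2.integrable_convolution (ContinuousLinearMap.lsmul ℝ ℝ) hki
  have hE : ∫ x, mol k (fun y => f y ^ 2) x = ∫ x, f x ^ 2 := by
    have := integral_convolution (ContinuousLinearMap.lsmul ℝ ℝ) hf2 hki
    rw [hk1] at this
    simpa [mol] using this
  have h0 : ∀ x, 0 ≤ mol k (fun y => f y ^ 2) x := fun x =>
    integral_nonneg fun t => mul_nonneg (sq_nonneg _) (hk0 _)
  calc _ ≤ ∫⁻ x in D, ENNReal.ofReal (mol k (fun y => f y ^ 2) x) :=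
        lintegral_mono fun x => ENNReal.ofReal_le_ofReal (mol_sq_le hk hkc hk0 hk1 hf hf2 x)
    _ ≤ ∫⁻ x, ENNReal.ofReal (mol k (fun y => f y ^ 2) x) := setLIntegral_le_lintegral _ _
    _ = _ := by
      rw [← hE, ofReal_integral_eq_lintegral_ofReal hI (Filter.Eventually.of_forall h0)]

/-- translated reflected test field -/
def tf (k : E2 → ℝ) (x : E2) (i : Fin 2) : E2 → Fin 2 → ℝ := fun y j => if j = i then k (x - y) else 0

lemma pd_refl {k : E2 → ℝ} (hk : ContDiff ℝ (⊤ : ℕ∞) k) (x y : E2) (i : Fin 2) :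
    pd i (fun y => k (x - y)) y = - pd i k (x - y) := by
  unfold pd
  have := ((hk.differentiable (by simp) (x - y)).hasFDerivAt).comp y ((hasFDerivAt_id y).const_sub x)
  have h2 : HasFDerivAt (fun y => k (x - y)) _ y := this
  rw [h2.fderiv]
  simp

lemma pd_zero' (i : Fin 2) (y : E2) : pd i (fun _ => (0:ℝ)) y = 0 := by simp [pd]

lemma tf_test {Ω : Set E2} {k : E2 → ℝ} (hk : ContDiff ℝ (⊤ : ℕ∞) k) {r : ℝ}
    (hks : tsupport k ⊆ Metric.closedBall 0 r) {x : E2} (hx : Metric.closedBall x r ⊆ Ω) (i : Fin 2) :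
    IsTest Ω (tf k x i) := by
  have hs : tsupport (tf k x i) ⊆ Metric.closedBall x r := by
    refine closure_minimal (fun y hy => ?_) Metric.isClosed_closedBall
    by_contra hn
    refine hy ?_
    have : k (x - y) = 0 := image_eq_zero_of_notMem_tsupport fun h => hn (by
      have := hks h
      rw [mem_closedBall_zero_iff] at this
      rwa [Metric.mem_closedBall, dist_comm, dist_eq_norm])
    ext j; simp [tf, this]
  refine ⟨fun j => ?_, (isCompact_closedBall x r).of_isClosed_subset (isClosed_tsupport _) hs, hs.trans hx⟩
  unfold tf
  split_ifs
  · exact hk.comp (contDiff_const.sub contDiff_id)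
  · exact contDiff_const

lemma curl_tf0 {k : E2 → ℝ} (hk : ContDiff ℝ (⊤ : ℕ∞) k) (x y : E2) :
    curlS (tf k x 0) y = pd 1 k (x - y) := by
  simp [curlS, tf, pd_refl hk, pd_zero']
lemma curl_tf1 {k : E2 → ℝ} (hk : ContDiff ℝ (⊤ : ℕ∞) k) (x y : E2) :
    curlS (tf k x 1) y = -pd 0 k (x - y) := by
  simp [curlS, tf, pd_refl hk, pd_zero']
lemma div_tf0 {k : E2 → ℝ} (hk : ContDiff ℝ (⊤ : ℕ∞) k) (x y : E2) :
    divS (tf k x 0) y = -pd 0 k (x - y) := by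
  simp [divS, tf, pd_refl hk, pd_zero']
lemma div_tf1 {k : E2 → ℝ} (hk : ContDiff ℝ (⊤ : ℕ∞) k) (x y : E2) :
    divS (tf k x 1) y = -pd 1 k (x - y) := by
  simp [divS, tf, pd_refl hk, pd_zero']

lemma ind_int_eq {Ω S : Set E2} (hS : S ⊆ Ω) (hΩ : MeasurableSet Ω) (f g : E2 → ℝ)
    (hg : ∀ t ∉ S, g t = 0) : ∫ t, S.indicator f t * g t = ∫ t in Ω, f t * g t := by
  rw [← integral_indicator hΩ]
  congr 1; ext t
  by_cases h : t ∈ S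
  · simp [h, hS h]
  · simp [h, hg t h, Set.indicator]

lemma mol_est {Ω : Set E2} (hopen : IsOpen Ω) (hbd : Bornology.IsBounded Ω)
    {ω : E2 → ℝ} (hω : ContDiffOn ℝ (⊤ : ℕ∞) ω Ω) {M : ℝ}
    {G : E2 → E2} (hG : MemLp G 2 (volume.restrict Ω))
    (hGM : ∫⁻ x in Ω, ENNReal.ofReal (‖G x‖ ^ 2) ≤ ENNReal.ofReal (M ^ 2))
    (hrep : ∀ φ, IsTest Ω φ → ∫ x in Ω, ω x * curlS φ x =
        ∫ x in Ω, (G x 0 * curlS φ x + G x 1 * divS φ x))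
    {D K : Set E2} (hDc : Convex ℝ D) (hDo : IsOpen D) (hK : IsCompact K) (hKΩ : K ⊆ Ω)
    {k : E2 → ℝ} (hk : ContDiff ℝ (⊤ : ℕ∞) k) {r : ℝ}
    (hks : tsupport k ⊆ Metric.closedBall 0 r) (hk0 : ∀ x, 0 ≤ k x) (hk1 : ∫ x, k x = 1)
    (hDK : ∀ x ∈ D, Metric.closedBall x r ⊆ K)
    {x0 : E2} {ρ R : ℝ} (hρ : 0 < ρ) (hR : 0 < R)
    (h1 : Metric.ball x0 ρ ⊆ D) (h2 : D ⊆ Metric.closedBall x0 R) :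
    ∃ c : ℝ, ∫⁻ x in D, ENNReal.ofReal ((mol k (K.indicator ω) x - c) ^ 2) ≤
      ENNReal.ofReal (2 * (R ^ 2 / ρ ^ 2 * (2 + 4 * (R / ρ) ^ 2) + 1) * M ^ 2) := by
  have hkc : HasCompactSupport k :=
    (isCompact_closedBall 0 r).of_isClosed_subset (isClosed_tsupport _) hks
  have : IsFiniteMeasure (volume.restrict Ω) := ⟨by simpa using hbd.measure_lt_top⟩
  have hGi : ∀ i, MemLp (fun x => G x i) 2 (volume.restrict Ω) := fun i =>
    hG.continuousLinearMap_comp (EuclideanSpace.proj i : E2 →L[ℝ] ℝ)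
  have hGint : ∀ i, Integrable (Ω.indicator fun x => G x i) := fun i =>
    (integrable_indicator_iff hopen.measurableSet).2 ((hGi i).integrable (by norm_num))
  have hGsq : ∀ i, (fun x => (Ω.indicator (fun x => G x i) x) ^ 2) = Ω.indicator fun x => G x i ^ 2 := by
    intro i; ext x; by_cases h : x ∈ Ω <;> simp [h]
  have hGint2 : ∀ i, Integrable fun x => (Ω.indicator (fun x => G x i) x) ^ 2 := fun i => by
    rw [hGsq]
    exact (integrable_indicator_iff hopen.measurableSet).2 (hGi i).integrable_sq
  have hGle : ∀ i, ENNReal.ofReal (∫ x, (Ω.indicator (fun x => G x i) x) ^ 2) ≤ ENNReal.ofReal (M ^ 2) := by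
    intro i
    rw [hGsq, integral_indicator hopen.measurableSet,
      ofReal_integral_eq_lintegral_ofReal (hGi i).integrable_sq
        (Filter.Eventually.of_forall fun x => sq_nonneg _)]
    refine le_trans (lintegral_mono fun x => ENNReal.ofReal_le_ofReal ?_) hGM
    have := PiLp.norm_apply_le (G x) i
    rw [← sq_abs, ← Real.norm_eq_abs]
    gcongr
  have hωint : Integrable (K.indicator ω) :=
    (integrable_indicator_iff hK.measurableSet).2
      ((hω.continuousOn.mono hKΩ).integrableOn_compact hK)
  have dω := fun x => mol_deriv hk hkc hωint.locallyIntegrable x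
  have dq := fun x => mol_deriv hk hkc (hGint 0).locallyIntegrable x
  have dr := fun x => mol_deriv hk hkc (hGint 1).locallyIntegrable x
  set wm := mol k (K.indicator ω)
  set qm := mol k (Ω.indicator fun x => G x 0)
  set rm := mol k (Ω.indicator fun x => G x 1)
  have hvan : ∀ x ∈ D, ∀ i, ∀ t ∉ K, pd i k (x - t) = 0 := by
    intro x hx i t ht
    refine image_eq_zero_of_notMem_tsupport fun h => ht (hDK x hx ?_)
    have := hks (pd_tsupport k i h)
    rw [mem_closedBall_zero_iff] at this
    rwa [Metric.mem_closedBall, dist_comm, dist_eq_norm]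
  have eω : ∀ x ∈ D, ∀ i, pd i wm x = ∫ t in Ω, ω t * pd i k (x - t) := fun x hx i => by
    rw [(dω x).2 i, ind_int_eq hKΩ hopen.measurableSet _ _ (hvan x hx i)]
  have eq : ∀ x ∈ D, ∀ i, pd i qm x = ∫ t in Ω, G t 0 * pd i k (x - t) := fun x hx i => by
    rw [(dq x).2 i, ind_int_eq subset_rfl hopen.measurableSet _ _
      fun t ht => hvan x hx i t fun h => ht (hKΩ h)]
  have er : ∀ x ∈ D, ∀ i, pd i rm x = ∫ t in Ω, G t 1 * pd i k (x - t) := fun x hx i => by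
    rw [(dr x).2 i, ind_int_eq subset_rfl hopen.measurableSet _ _
      fun t ht => hvan x hx i t fun h => ht (hKΩ h)]
  have hitg : ∀ x j i, Integrable (fun t => G t j * pd i k (x - t)) (volume.restrict Ω) := by
    intro x j i
    have := mul_bdd_int (pd_cont hk i) (pd_hcs hkc i) (hGint j).locallyIntegrable x
    rw [← IntegrableOn, ← integrable_indicator_iff hopen.measurableSet]
    refine this.congr (Filter.Eventually.of_forall fun t => ?_)
    by_cases h : t ∈ Ω <;> simp [h]
  have hitgn : ∀ x j i, Integrable (fun t => -(G t j * pd i k (x - t))) (volume.restrict Ω) :=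
    fun x j i => (hitg x j i).neg
  have pda : ∀ x i, pd i (fun x => wm x - qm x) x = pd i wm x - pd i qm x := by
    intro x i
    unfold pd
    rw [fderiv_fun_sub (dω x).1 (dq x).1]; rfl
  have cr1 : ∀ x ∈ D, pd 0 (fun x => wm x - qm x) x = pd 1 rm x := by
    intro x hx
    have := hrep _ (tf_test hk hks ((hDK x hx).trans hKΩ) 1)
    simp only [curl_tf1 hk, div_tf1 hk, mul_neg] at this
    rw [integral_add (hitgn x 0 0) (hitgn x 1 1), integral_neg, integral_neg, integral_neg] at this
    rw [pda, eω x hx, eq x hx, er x hx]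
    linarith
  have cr2 : ∀ x ∈ D, pd 1 (fun x => wm x - qm x) x = - pd 0 rm x := by
    intro x hx
    have := hrep _ (tf_test hk hks ((hDK x hx).trans hKΩ) 0)
    simp only [curl_tf0 hk, div_tf0 hk, mul_neg] at this
    rw [integral_add (hitg x 0 1) (hitgn x 1 0), integral_neg] at this
    rw [pda, eω x hx, eq x hx, er x hx]
    linarith
  have hfr := friedrichs_E2 hDc hDo hρ hR h1 h2 (fun x => wm x - qm x) rm
    (fun x _ => (dω x).1.sub (dq x).1) (fun x _ => (dr x).1) cr1 cr2
  set c := wm x0 - qm x0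
  have hr := (mol_L2 hk.continuous hkc hk0 hk1 (hGint 1) (hGint2 1) D).trans (hGle 1)
  have hq := (mol_L2 hk.continuous hkc hk0 hk1 (hGint 0) (hGint2 0) D).trans (hGle 0)
  have hcw : Continuous wm := continuous_iff_continuousAt.2 fun x => (dω x).1.continuousAt
  have hcq : Continuous qm := continuous_iff_continuousAt.2 fun x => (dq x).1.continuousAt
  refine ⟨c, ?_⟩
  calc ∫⁻ x in D, ENNReal.ofReal ((wm x - c) ^ 2)
      ≤ ∫⁻ x in D, (2 * ENNReal.ofReal ((wm x - qm x - c) ^ 2) + 2 * ENNReal.ofReal (qm x ^ 2)) := by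
        refine lintegral_mono fun x => ?_
        have e2 : (2 : ENNReal) = ENNReal.ofReal 2 := by simp
        rw [e2, ← ENNReal.ofReal_mul (by norm_num), ← ENNReal.ofReal_mul (by norm_num),
          ← ENNReal.ofReal_add (by positivity) (by positivity)]
        refine ENNReal.ofReal_le_ofReal ?_
        nlinarith [sq_nonneg (wm x - qm x - c - qm x)]
    _ = 2 * (∫⁻ x in D, ENNReal.ofReal ((wm x - qm x - c) ^ 2)) +
        2 * (∫⁻ x in D, ENNReal.ofReal (qm x ^ 2)) := by
        rw [lintegral_add_left, lintegral_const_mul, lintegral_const_mul]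
        · fun_prop
        · fun_prop
        · fun_prop
    _ ≤ 2 * (ENNReal.ofReal (R ^ 2 / ρ ^ 2) *
      (ENNReal.ofReal (2 + 4 * (R / ρ) ^ 2) * ENNReal.ofReal (M ^ 2))) + 2 * ENNReal.ofReal (M ^ 2) := by
        gcongr
        exact hfr.trans (by gcongr)
    _ = _ := by
        have e2 : (2 : ENNReal) = ENNReal.ofReal 2 := by simp
        rw [e2, ← ENNReal.ofReal_mul (by positivity), ← ENNReal.ofReal_mul (by positivity),
          ← ENNReal.ofReal_mul (by positivity), ← ENNReal.ofReal_mul (by positivity),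
          ← ENNReal.ofReal_add (by positivity) (by positivity)]
        congr 1; ring

lemma approx {Ω : Set E2} (hconv : Convex ℝ Ω) (hopen : IsOpen Ω) (hbd : Bornology.IsBounded Ω)
    {ω : E2 → ℝ} (hω : ContDiffOn ℝ (⊤ : ℕ∞) ω Ω) {M : ℝ}
    {G : E2 → E2} (hG : MemLp G 2 (volume.restrict Ω))
    (hGM : ∫⁻ x in Ω, ENNReal.ofReal (‖G x‖ ^ 2) ≤ ENNReal.ofReal (M ^ 2))
    (hrep : ∀ φ, IsTest Ω φ → ∫ x in Ω, ω x * curlS φ x =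
        ∫ x in Ω, (G x 0 * curlS φ x + G x 1 * divS φ x))
    {x0 : E2} {ρ R : ℝ} (hρ : 0 < ρ) (hR : 0 < R)
    (h1 : Metric.ball x0 (2 * ρ) ⊆ Ω) (h2 : Ω ⊆ Metric.closedBall x0 R) :
    ∃ (w : ℕ → E2 → ℝ) (c : ℕ → ℝ) (D : ℕ → Set E2), (∀ n, Continuous (w n)) ∧
      (∀ n, IsOpen (D n)) ∧ (∀ n, Metric.ball x0 ρ ⊆ D n) ∧
      (∀ x ∈ Ω, ∀ᶠ n in Filter.atTop, x ∈ D n) ∧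
      (∀ x ∈ Ω, Filter.Tendsto (fun n => w n x) Filter.atTop (nhds (ω x))) ∧
      ∀ n, ∫⁻ x in D n, ENNReal.ofReal ((w n x - c n) ^ 2) ≤
      ENNReal.ofReal (2 * (R ^ 2 / ρ ^ 2 * (2 + 4 * (R / ρ) ^ 2) + 1) * M ^ 2) := by
  have hne : (Ωᶜ).Nonempty := by
    rw [Set.nonempty_compl]
    rintro rfl
    exact NormedSpace.unbounded_univ ℝ E2 hbd
  let d : E2 → ℝ := fun x => Metric.infDist x Ωᶜ
  have hdc : Continuous d := Metric.continuous_infDist_pt _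
  have hdΩ : ∀ x, Metric.ball x (d x) ⊆ Ω := fun x => Metric.ball_infDist_compl_subset
  have hdle : ∀ x s, Metric.ball x s ⊆ Ω → s ≤ d x := by
    intro x s hs
    refine (Metric.le_infDist hne).2 fun y hy => ?_
    by_contra hlt
    exact hy (hs (by rw [Metric.mem_ball, dist_comm]; exact not_le.1 hlt))
  have hdpos : ∀ x ∈ Ω, 0 < d x := fun x hx => by
    obtain ⟨s, hs, hb⟩ := Metric.isOpen_iff.1 hopen x hx
    exact hs.trans_le (hdle x s hb)
  have hmemΩ : ∀ x, 0 < d x → x ∈ Ω := fun x hx => hdΩ x (Metric.mem_ball_self hx)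
  have hdlip : ∀ x y, d x ≤ d y + dist x y := fun x y => Metric.infDist_le_infDist_add_dist
  let δ : ℕ → ℝ := fun n => ρ / (n + 2)
  have hδ : ∀ n, 0 < δ n := fun n => by positivity
  have hδρ : ∀ n, δ n < ρ := fun n => by
    refine div_lt_self hρ ?_
    have : (0:ℝ) ≤ n := Nat.cast_nonneg n
    linarith
  have hδ0 : Filter.Tendsto δ Filter.atTop (nhds 0) :=
    Filter.Tendsto.div_atTop tendsto_const_nhds
      (Filter.tendsto_atTop_add_const_right _ _ tendsto_natCast_atTop_atTop)
  let D : ℕ → Set E2 := fun n => {x | δ n < d x}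
  let K : ℕ → Set E2 := fun n => {x | δ n / 2 ≤ d x}
  have hDo : ∀ n, IsOpen (D n) := fun n => isOpen_lt continuous_const hdc
  have hKΩ : ∀ n, K n ⊆ Ω := fun n x hx => hmemΩ x (lt_of_lt_of_le (by have := hδ n; linarith) hx)
  have hDΩ : ∀ n, D n ⊆ Ω := fun n x hx => hmemΩ x ((hδ n).trans hx)
  have hK : ∀ n, IsCompact (K n) := fun n =>
    Metric.isCompact_of_isClosed_isBounded (isClosed_le continuous_const hdc) (hbd.subset (hKΩ n))
  have hDc : ∀ n, Convex ℝ (D n) := by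
    intro n x hx y hy a b ha hb hab
    have : min (d x) (d y) ≤ d (a • x + b • y) := by
      refine hdle _ _ fun z hz => ?_
      set v := z - (a • x + b • y) with hv
      have hvn : ‖v‖ < min (d x) (d y) := by rwa [Metric.mem_ball, dist_eq_norm] at hz
      have hxv : x + v ∈ Ω := hdΩ x (by simpa [dist_eq_norm] using hvn.trans_le (min_le_left _ _))
      have hyv : y + v ∈ Ω := hdΩ y (by simpa [dist_eq_norm] using hvn.trans_le (min_le_right _ _))
      have := hconv hxv hyv ha hb hab
      have e : z = a • (x + v) + b • (y + v) := by
        have : a • (x + v) + b • (y + v) = (a • x + b • y) + (a + b) • v := by module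
        rw [this, hab, one_smul, hv]; abel
      rwa [e]
    exact (lt_min hx hy).trans_le this
  have hDK : ∀ n, ∀ x ∈ D n, Metric.closedBall x (δ n / 2) ⊆ K n := by
    intro n x hx y hy
    have h := hdlip x y
    rw [Metric.mem_closedBall, dist_comm] at hy
    have hx' : δ n < d x := hx
    show δ n / 2 ≤ d y
    linarith
  have hball : ∀ n, Metric.ball x0 ρ ⊆ D n := by
    intro n x hx
    refine (hδρ n).trans_le (hdle x ρ fun y hy => h1 ?_)
    rw [Metric.mem_ball] at *
    linarith [dist_triangle y x x0]
  let η : ∀ n, ContDiffBump (0 : E2) := fun n =>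
    ⟨δ n / 4, δ n / 2, by have := hδ n; positivity, by have := hδ n; linarith⟩
  let k : ℕ → E2 → ℝ := fun n => (η n).normed volume
  have hωint : ∀ n, Integrable ((K n).indicator ω) := fun n =>
    (integrable_indicator_iff (hK n).measurableSet).2
      ((hω.continuousOn.mono (hKΩ n)).integrableOn_compact (hK n))
  have hev : ∀ x ∈ Ω, ∀ᶠ n in Filter.atTop, x ∈ D n := fun x hx =>
    hδ0.eventually_lt_const (hdpos x hx)
  choose c hc using fun n => mol_est hopen hbd hω hG hGM hrep (hDc n) (hDo n) (hK n) (hKΩ n)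
    (k := k n) (η n).contDiff_normed (r := δ n / 2) (η n).tsupport_normed_eq.subset
    (fun x => (η n).nonneg_normed x) (η n).integral_normed (hDK n) hρ hR (hball n) ((hDΩ n).trans h2)
  refine ⟨fun n => mol (k n) ((K n).indicator ω), c, D, fun n => ?_, hDo, hball, hev, ?_, hc⟩
  · exact continuous_iff_continuousAt.2 fun x => (mol_deriv (η n).contDiff_normed
      (η n).hasCompactSupport_normed (hωint n).locallyIntegrable x).1.continuousAt
  · intro x hx
    rw [Metric.tendsto_nhds]
    intro ε hε
    have hcx : ContinuousAt ω x := hω.continuousOn.continuousAt (hopen.mem_nhds hx)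
    obtain ⟨s, hs, hsb⟩ := Metric.continuousAt_iff.1 hcx (ε / 2) (by positivity)
    filter_upwards [hev x hx, hδ0.eventually_lt_const hs] with n hn hns
    have hxK : x ∈ K n := hDK n x hn (Metric.mem_closedBall_self (by have := hδ n; positivity))
    have := (η n).dist_normed_convolution_le (μ := volume) (g := (K n).indicator ω) (x₀ := x)
      (ε := ε / 2) (hωint n).aestronglyMeasurable (by
        intro y hy
        have hy' : dist y x < δ n / 2 := hy
        have hyK : y ∈ K n := hDK n x hn hy'.le
        rw [Set.indicator_of_mem hxK, Set.indicator_of_mem hyK]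
        exact (hsb (by have := hδ n; linarith)).le)
    rw [Set.indicator_of_mem hxK, convolution_lsmul_swap] at this
    have e : mol (k n) ((K n).indicator ω) x = ∫ t, (η n).normed volume (x - t) • (K n).indicator ω t := by
      rw [mol_apply]
      congr 1; ext t
      rw [smul_eq_mul, mul_comm]
    rw [e]
    linarith

lemma fatou_final {Ω : Set E2} (hopen : IsOpen Ω)
    {ω : E2 → ℝ} {x0 : E2} {ρ A : ℝ} (hρ : 0 < ρ) (hBΩ : Metric.ball x0 ρ ⊆ Ω)
    {w : ℕ → E2 → ℝ} {c : ℕ → ℝ} {D : ℕ → Set E2} (hwc : ∀ n, Continuous (w n))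
    (hDo : ∀ n, IsOpen (D n)) (hB : ∀ n, Metric.ball x0 ρ ⊆ D n)
    (hev : ∀ x ∈ Ω, ∀ᶠ n in Filter.atTop, x ∈ D n)
    (hlim : ∀ x ∈ Ω, Filter.Tendsto (fun n => w n x) Filter.atTop (nhds (ω x)))
    (hest : ∀ n, ∫⁻ x in D n, ENNReal.ofReal ((w n x - c n) ^ 2) ≤ ENNReal.ofReal A) :
    ∃ y, ∫⁻ x in Ω, ENNReal.ofReal ((ω x - ω y) ^ 2) ≤
      (2 + 2 * volume Ω / volume (Metric.ball x0 ρ)) * ENNReal.ofReal A := by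
  set B := Metric.ball x0 ρ
  have hv0 : volume B ≠ 0 := (Metric.measure_ball_pos _ _ hρ).ne'
  have hvt : volume B ≠ ⊤ := Metric.isBounded_ball.measure_lt_top.ne
  let f : ℕ → E2 → ENNReal := fun n y =>
    2 * ENNReal.ofReal A + 2 * volume Ω * ENNReal.ofReal ((w n y - c n) ^ 2)
  have hfm : ∀ n, Measurable (f n) := fun n => by
    have := (hwc n).measurable
    fun_prop
  have step1 : ∀ y ∈ B, ∫⁻ x in Ω, ENNReal.ofReal ((ω x - ω y) ^ 2) ≤
      Filter.liminf (fun n => f n y) Filter.atTop := by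
    intro y hy
    let g : ℕ → E2 → ENNReal := fun n => (D n).indicator fun x => ENNReal.ofReal ((w n x - w n y) ^ 2)
    have hgm : ∀ n, Measurable (g n) := fun n => by
      refine Measurable.indicator ?_ (hDo n).measurableSet
      have := (hwc n).measurable
      fun_prop
    calc ∫⁻ x in Ω, ENNReal.ofReal ((ω x - ω y) ^ 2)
        = ∫⁻ x in Ω, Filter.liminf (fun n => g n x) Filter.atTop := by
          refine setLIntegral_congr_fun hopen.measurableSet fun x hx => ?_
          symm
          refine Filter.Tendsto.liminf_eq ?_
          have ht : Filter.Tendsto (fun n => ENNReal.ofReal ((w n x - w n y) ^ 2)) Filter.atTop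
              (nhds (ENNReal.ofReal ((ω x - ω y) ^ 2))) :=
            ENNReal.tendsto_ofReal (((hlim x hx).sub (hlim y (hBΩ hy))).pow 2)
          refine ht.congr' ?_
          filter_upwards [hev x hx] with n hn
          simp [g, hn]
      _ ≤ Filter.liminf (fun n => ∫⁻ x in Ω, g n x) Filter.atTop := lintegral_liminf_le hgm
      _ ≤ _ := by
          refine Filter.liminf_le_liminf (Filter.Eventually.of_forall fun n => ?_)
          have e2 : (2 : ENNReal) = ENNReal.ofReal 2 := by simp
          have hwm := (hwc n).measurable
          calc ∫⁻ x in Ω, g n x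
              ≤ ∫⁻ x in Ω, ((D n).indicator (fun x => 2 * ENNReal.ofReal ((w n x - c n) ^ 2)) x
                  + 2 * ENNReal.ofReal ((w n y - c n) ^ 2)) := by
                refine lintegral_mono fun x => ?_
                by_cases h : x ∈ D n
                · simp only [g, Set.indicator_of_mem h]
                  rw [e2, ← ENNReal.ofReal_mul (by norm_num), ← ENNReal.ofReal_mul (by norm_num),
                    ← ENNReal.ofReal_add (by positivity) (by positivity)]
                  refine ENNReal.ofReal_le_ofReal ?_
                  nlinarith [sq_nonneg (w n x - c n + (w n y - c n))]
                · simp [g, h]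
            _ = (∫⁻ x in Ω, (D n).indicator (fun x => 2 * ENNReal.ofReal ((w n x - c n) ^ 2)) x)
                  + 2 * ENNReal.ofReal ((w n y - c n) ^ 2) * volume Ω := by
                rw [lintegral_add_right _ measurable_const, setLIntegral_const]
            _ ≤ 2 * ENNReal.ofReal A + 2 * ENNReal.ofReal ((w n y - c n) ^ 2) * volume Ω := by
                gcongr
                refine (setLIntegral_le_lintegral _ _).trans ?_
                rw [lintegral_indicator (hDo n).measurableSet, lintegral_const_mul _ (by fun_prop)]
                gcongr
                exact hest n
            _ = f n y := by simp only [f]; ring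
  have step2 : ∫⁻ y in B, Filter.liminf (fun n => f n y) Filter.atTop ≤
      2 * ENNReal.ofReal A * volume B + 2 * volume Ω * ENNReal.ofReal A := by
    refine (lintegral_liminf_le hfm).trans ?_
    refine Filter.liminf_le_of_le (by isBoundedDefault) fun b hb => ?_
    obtain ⟨n, hn⟩ := hb.exists
    refine hn.trans ?_
    have hwm := (hwc n).measurable
    simp only [f]
    rw [lintegral_add_left measurable_const, setLIntegral_const, lintegral_const_mul _ (by fun_prop)]
    gcongr
    exact (lintegral_mono_set (hB n)).trans (hest n)
  obtain ⟨y, hyB, hy⟩ := exists_le_setLAverage (μ := volume) hv0 hvt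
    (f := fun y => Filter.liminf (fun n => f n y) Filter.atTop)
    (Measurable.liminf hfm).aemeasurable
  refine ⟨y, (step1 y hyB).trans (hy.trans ?_)⟩
  rw [setLAverage_eq]
  refine (ENNReal.div_le_div_right step2 _).trans (le_of_eq ?_)
  rw [ENNReal.add_div, ENNReal.mul_div_cancel_right hv0 hvt, add_mul, ENNReal.div_eq_inv_mul, ENNReal.div_eq_inv_mul]
  ring

/-- Smooth-data version of the quantitative scalar curl-potential estimate
(Costabel–McIntosh with `s = −1`). -/
theorem statement1 (Ω : Set E2) (hne : Ω.Nonempty) (hbd : Bornology.IsBounded Ω)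
    (hconv : Convex ℝ Ω) (hopen : IsOpen Ω) :
    ∃ C : ℝ, 0 < C ∧
      ∀ τ : E2 → Fin 2 → ℝ,
        (∀ i, ContDiffOn ℝ (⊤ : ℕ∞) (fun x => τ x i) Ω) →
        (∀ x ∈ Ω, pd 0 (fun y => τ y 0) x + pd 1 (fun y => τ y 1) x = 0) →
        ∀ M : ℝ, 0 ≤ M →
        (∀ φ : E2 → Fin 2 → ℝ,
          (∀ i, ContDiff ℝ (⊤ : ℕ∞) (fun x => φ x i)) →
          HasCompactSupport φ → tsupport φ ⊆ Ω →
          (∫ x in Ω, frob (jac φ x) (jac φ x)) ≤ 1 →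
          (∫ x in Ω, ∑ i, τ x i * φ x i) ≤ M) →
        ∃ ω : E2 → ℝ, ContDiffOn ℝ (⊤ : ℕ∞) ω Ω ∧
          (∀ x ∈ Ω, pd 1 ω x = τ x 0 ∧ -(pd 0 ω x) = τ x 1) ∧
          (∫ x in Ω, (ω x) ^ 2) ≤ C * M ^ 2 := by
  obtain ⟨x0, hx0⟩ := hne
  obtain ⟨s, hs, hsΩ⟩ := Metric.isOpen_iff.1 hopen x0 hx0
  obtain ⟨R, hR, hΩR⟩ := hbd.subset_closedBall_lt 0 x0
  have hρ : 0 < s / 2 := by positivity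
  have h1 : Metric.ball x0 (2 * (s / 2)) ⊆ Ω := by rwa [mul_div_cancel₀ s (by norm_num : (2:ℝ) ≠ 0)]
  set C' : ℝ := 2 * (R ^ 2 / (s / 2) ^ 2 * (2 + 4 * (R / (s / 2)) ^ 2) + 1) with hC'
  have hC'pos : 0 < C' := by positivity
  set q : ENNReal := 2 + 2 * volume Ω / volume (Metric.ball x0 (s / 2)) with hq
  have hv0 : volume (Metric.ball x0 (s / 2)) ≠ 0 := (Metric.measure_ball_pos _ _ hρ).ne'
  have hqt : q ≠ ⊤ := by
    refine ENNReal.add_ne_top.2 ⟨by simp, ENNReal.div_ne_top (ENNReal.mul_ne_top (by simp) hbd.measure_lt_top.ne) hv0⟩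
  refine ⟨q.toReal * C' + 1, by positivity, fun τ hτ hdiv M hM hyp => ?_⟩
  obtain ⟨ω, hω, hωτ⟩ := exists_potential hconv hopen τ hτ hdiv
  obtain ⟨G, hG, hGM, hrep⟩ := exists_rep hopen hω hωτ hM hyp
  obtain ⟨w, c, D, hwc, hDo, hB, hev, hlim, hest⟩ := approx hconv hopen hbd hω hG hGM hrep hρ hR h1 hΩR
  obtain ⟨y, hy⟩ := fatou_final hopen hρ ((Metric.ball_subset_ball (by linarith)).trans h1)
    hwc hDo hB hev hlim hest
  refine ⟨fun x => ω x - ω y, hω.sub contDiffOn_const, fun x hx => ?_, ?_⟩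
  · have e : ∀ i, pd i (fun x => ω x - ω y) x = pd i ω x := fun i => by
      unfold pd
      rw [fderiv_sub_const]
    rw [e, e]
    exact hωτ x hx
  · have hm : AEStronglyMeasurable (fun x => (ω x - ω y) ^ 2) (volume.restrict Ω) :=
      ((hω.continuousOn.sub continuousOn_const).pow 2).aestronglyMeasurable hopen.measurableSet
    rw [integral_eq_lintegral_of_nonneg_ae (Filter.Eventually.of_forall fun x => sq_nonneg _) hm]
    refine (ENNReal.toReal_mono (ENNReal.mul_ne_top hqt ENNReal.ofReal_ne_top) hy).trans ?_
    rw [ENNReal.toReal_mul, ENNReal.toReal_ofReal (by positivity)]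
    rw [← hC', ← mul_assoc]
    linarith [sq_nonneg M, add_mul (q.toReal * C') 1 (M ^ 2)]

end
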